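/- arXiv:2401.11587 — 3 statements merged into one kernel-verified Lean document; each statement's English description precedes it below -/
import Mathlib

section
/- Let ℓ ≥ 4 be even, s ≥ 0, k = (ℓ−2)/2, and r ≥ 2. For all sufficiently large n, every n-vertex B(ℓ,s)-free graph G satisfies e_r(G) ≤ k·(n−1)^r + (n−k)·k^r, with equality if and only if G is isomorphic to H(k,n). -/
open scoped Classical
open Finset SimpleGraph

/-- The broom `B(ℓ,s)`: a path on vertices `0,…,ℓ-1` plus `s` extra leaves
`ℓ,…,ℓ+s-1` attached to the penultimate vertex `ℓ-2` of the path. -/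
def broom (ℓ s : ℕ) : SimpleGraph (Fin (ℓ + s)) :=
  SimpleGraph.fromRel (fun a b => (a.val + 1 = b.val ∧ b.val < ℓ) ∨ (a.val = ℓ - 2 ∧ ℓ ≤ b.val))

/-- `G` contains no subgraph isomorphic to the broom `B(ℓ,s)`. -/
def BroomFree (ℓ s : ℕ) {V : Type*} (G : SimpleGraph V) : Prop :=
  ¬ ∃ f : broom ℓ s →g G, Function.Injective f

/-- `H(k,n)`: the complete bipartite graph `K_{k,n-k}` with all edges added inside
the part `{0,…,k-1}` of size `k`. -/
noncomputable def Hgraph (k n : ℕ) : SimpleGraph (Fin n) :=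
  SimpleGraph.fromRel (fun a b => a.val < k ∨ b.val < k)


section Broom

variable {V : Type*} [Fintype V] {G : SimpleGraph V} {ℓ s : ℕ}

/-- In a broom-free graph, a path on `ℓ - 1` vertices ends in a vertex of small degree. -/
lemma BroomFree.degree_lt_of_path (hG : BroomFree ℓ s G) (hℓ : 4 ≤ ℓ) {l : List V}
    (hlen : l.length + 1 = ℓ) (hc : l.IsChain G.Adj) (hn : l.Nodup) {c : V}
    (hlast : l.getLast? = some c) : G.degree c < ℓ + s := by
  by_contra! hdeg
  obtain ⟨N, hN⟩ : ∃ N, N = G.neighborFinset c \ l.toFinset := ⟨_, rfl⟩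
  have hNcard : s + 1 ≤ #N := by
    have h1 := Finset.le_card_sdiff l.toFinset (G.neighborFinset c)
    have h2 := l.toFinset_card_le
    rw [G.card_neighborFinset_eq_degree, ← hN] at h1
    omega
  have hNmem (x : N) : G.Adj c x ∧ (x : V) ∉ l := by
    obtain ⟨x, hx⟩ := x
    simpa [hN] using hx
  have hc' : l[ℓ - 2]'(by omega) = c := by
    rw [List.getLast?_eq_getElem?, List.getElem?_eq_some_iff] at hlast
    obtain ⟨h, h'⟩ := hlast
    rw [← h']
    congr 1
    omega
  let f : Fin (ℓ + s) → V := fun i =>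
    if h : i.val < ℓ - 1 then l[i.val]'(by omega)
    else N.equivFin.symm ⟨i.val - (ℓ - 1), by have := i.2; omega⟩
  have key (a b : Fin (ℓ + s)) (hab : (a.val + 1 = b.val ∧ b.val < ℓ) ∨
      (a.val = ℓ - 2 ∧ ℓ ≤ b.val)) : G.Adj (f a) (f b) := by
    by_cases hb : b.val < ℓ - 1
    · have ha : a.val < ℓ - 1 := by omega
      simp only [f, dif_pos ha, dif_pos hb]
      have hab' : b.val = a.val + 1 := by omega
      simp only [hab']
      exact List.isChain_iff_getElem.1 hc _ _
    · have ha : a.val = ℓ - 2 := by omega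
      have ha' : a.val < ℓ - 1 := by omega
      simp only [f, dif_pos ha', dif_neg hb, ha, hc']
      exact (hNmem _).1
  refine hG ⟨⟨f, ?_⟩, ?_⟩
  · intro a b hab
    rw [broom, SimpleGraph.fromRel_adj] at hab
    rcases hab.2 with h | h
    · exact key a b h
    · exact (key b a h).symm
  · intro a b hab
    change f a = f b at hab
    by_cases ha : a.val < ℓ - 1 <;> by_cases hb : b.val < ℓ - 1
    · simp only [f, dif_pos ha, dif_pos hb] at hab
      exact Fin.ext ((hn.getElem_inj_iff).1 hab)
    · simp only [f, dif_pos ha, dif_neg hb] at hab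
      exact absurd (hab ▸ List.getElem_mem _) (hNmem _).2
    · simp only [f, dif_neg ha, dif_pos hb] at hab
      exact absurd (hab ▸ List.getElem_mem _) (hNmem _).2
    · simp only [f, dif_neg ha, dif_neg hb] at hab
      have := N.equivFin.symm.injective (Subtype.ext hab)
      rw [Fin.mk.injEq] at this
      exact Fin.ext (by omega)

variable [DecidableEq V]

/-- Vertices with many pairwise common neighbours lie on an alternating path that avoids a
given small set. -/
lemma exists_alternating_path {T : ℕ} (vs : List V) : ∀ (a : V) (F : Finset V),
    (a :: vs).Nodup → (∀ x ∈ a :: vs, ∀ y ∈ a :: vs, x ≠ y →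
      T ≤ #(G.neighborFinset x ∩ G.neighborFinset y)) →
    (∀ x ∈ a :: vs, x ∉ F) → #F + 2 * (a :: vs).length ≤ T →
    ∃ l : List V, (a :: l).IsChain G.Adj ∧ (a :: l).Nodup ∧ l.length = 2 * vs.length ∧
      (∀ x ∈ a :: l, x ∉ F) ∧ ∃ c ∈ a :: vs, (a :: l).getLast? = some c := by
  induction vs with
  | nil =>
    intro a F _ _ hF _
    exact ⟨[], by simp, by simp, by simp, hF, a, by simp, by simp⟩
  | cons b vs ih =>
    intro a F hn hT hF hcard
    have hab : a ≠ b := by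
      rintro rfl
      simp at hn
    obtain ⟨w, hw, hw'⟩ : ∃ w ∈ G.neighborFinset a ∩ G.neighborFinset b,
        w ∉ F ∪ (a :: b :: vs).toFinset := by
      apply Finset.exists_mem_notMem_of_card_lt_card
      have h1 := hT a (by simp) b (by simp) hab
      have h2 := Finset.card_union_le F (a :: b :: vs).toFinset
      have h3 := (a :: b :: vs).toFinset_card_le
      simp only [List.length_cons] at *
      omega
    rw [Finset.mem_inter, mem_neighborFinset, mem_neighborFinset] at hw
    rw [Finset.mem_union, not_or, List.mem_toFinset] at hw'
    obtain ⟨l, hl1, hl2, hl3, hl4, c, hc, hl5⟩ := ih b (insert a (insert w F)) hn.of_cons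
      (fun x hx y hy => hT x (List.mem_cons_of_mem _ hx) y (List.mem_cons_of_mem _ hy))
      (fun x hx hxF => by
        rw [Finset.mem_insert, Finset.mem_insert] at hxF
        rcases hxF with rfl | rfl | hxF
        · exact (List.nodup_cons.1 hn).1 hx
        · exact hw'.2 (List.mem_cons_of_mem _ hx)
        · exact hF x (List.mem_cons_of_mem _ hx) hxF)
      (by
        have h1 := Finset.card_insert_le a (insert w F)
        have h2 := Finset.card_insert_le w F
        simp only [List.length_cons] at *
        omega)
    refine ⟨w :: b :: l, ?_, ?_, ?_, ?_, c, List.mem_cons_of_mem _ hc, ?_⟩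
    · exact List.isChain_cons_cons.2 ⟨hw.1, List.isChain_cons_cons.2 ⟨hw.2.symm, hl1⟩⟩
    · have haw : a ≠ w := hw.1.ne
      have ha : a ∉ b :: l := fun h => hl4 a h (by simp)
      have hwl : w ∉ b :: l := fun h => hl4 w h (by simp)
      exact List.nodup_cons.2 ⟨by
        rw [List.mem_cons, not_or]
        exact ⟨haw, ha⟩, List.nodup_cons.2 ⟨hwl, hl2⟩⟩
    · simp [hl3]
      ring
    · intro x hx hxF
      rw [List.mem_cons, List.mem_cons] at hx
      rcases hx with rfl | rfl | hx
      · exact hF x (by simp) hxF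
      · exact hw'.1 hxF
      · exact hl4 x hx (by simp [hxF])
    · rw [List.getLast?_cons_cons, List.getLast?_cons_cons, hl5]

/-- Every vertex set of a broom-free graph spans only linearly many edges. -/
lemma BroomFree.sum_card_filter_adj_le (hG : BroomFree ℓ s G) (hℓ : 4 ≤ ℓ) (X : Finset V) :
    ∑ v ∈ X, #{w ∈ X | G.Adj v w} ≤ 2 * (ℓ + s) * #X := by
  induction X using Finset.strongInduction with
  | H X ih =>
    rcases X.eq_empty_or_nonempty with rfl | ⟨x₀, hx₀⟩
    · simp
    obtain ⟨v, hv, hdeg⟩ : ∃ v ∈ X, #{w ∈ X | G.Adj v w} < ℓ + s := by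
      by_contra! hmin
      have path (j : ℕ) : j < ℓ + s → ∃ a l, (a :: l).IsChain G.Adj ∧ (a :: l).Nodup ∧
          l.length = j ∧ ∀ x ∈ a :: l, x ∈ X := by
        induction j with
        | zero => exact fun _ => ⟨x₀, [], by simp, by simp, rfl, by simpa using hx₀⟩
        | succ j ihj =>
          intro hj
          obtain ⟨a, l, h1, h2, h3, h4⟩ := ihj (by omega)
          obtain ⟨w, hw, hw'⟩ : ∃ w ∈ ({w ∈ X | G.Adj a w} : Finset V), w ∉ (a :: l).toFinset := by
            by_contra! hsub
            have hle := Finset.card_le_card (t := (a :: l).toFinset.erase a)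
              (s := {w ∈ X | G.Adj a w}) (fun w hw => Finset.mem_erase.2
                ⟨fun h => by simp [h] at hw, hsub w hw⟩)
            have h5 := hmin a (h4 a (by simp))
            rw [Finset.card_erase_of_mem (by simp)] at hle
            have h6 := (a :: l).toFinset_card_le
            simp only [List.length_cons] at h6
            omega
          rw [Finset.mem_filter] at hw
          rw [List.mem_toFinset] at hw'
          refine ⟨w, a :: l, List.isChain_cons_cons.2 ⟨hw.2.symm, h1⟩,
            List.nodup_cons.2 ⟨hw', h2⟩, by simp [h3], ?_⟩
          intro x hx
          rcases List.mem_cons.1 hx with rfl | hx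
          · exact hw.1
          · exact h4 x hx
      obtain ⟨a, l, h1, h2, h3, h4⟩ := path (ℓ - 2) (by omega)
      have hlast := List.getLast?_eq_some_getLast (List.cons_ne_nil a l)
      have hlt := hG.degree_lt_of_path hℓ (by simp only [List.length_cons]; omega) h1 h2 hlast
      have hge := hmin _ (h4 _ (List.getLast_mem (List.cons_ne_nil a l)))
      have : #{w ∈ X | G.Adj ((a :: l).getLast (List.cons_ne_nil a l)) w} ≤
          G.degree ((a :: l).getLast (List.cons_ne_nil a l)) := by
        rw [← G.card_neighborFinset_eq_degree]
        exact Finset.card_le_card fun w hw => by simpa using (Finset.mem_filter.1 hw).2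
      omega
    have h1 := ih (X.erase v) (Finset.erase_ssubset hv)
    have h2 : ∑ u ∈ X.erase v, #{w ∈ X | G.Adj u w} ≤
        ∑ u ∈ X.erase v, (#{w ∈ X.erase v | G.Adj u w} + if G.Adj v u then 1 else 0) := by
      refine Finset.sum_le_sum fun u _ => ?_
      conv_lhs => rw [← Finset.insert_erase hv, Finset.filter_insert]
      by_cases h : G.Adj v u
      · rw [if_pos h.symm, if_pos h]
        exact Finset.card_insert_le _ _
      · rw [if_neg (fun h' => h h'.symm), if_neg h]
        simp
    rw [Finset.sum_add_distrib, ← Finset.card_filter] at h2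
    have h3 : #{u ∈ X.erase v | G.Adj v u} ≤ #{u ∈ X | G.Adj v u} :=
      Finset.card_le_card (Finset.filter_subset_filter _ (Finset.erase_subset _ _))
    rw [← Finset.add_sum_erase X _ hv]
    have h4 : #X = #(X.erase v) + 1 := (Finset.card_erase_add_one hv).symm
    rw [h4, mul_add]
    omega

/-- `(ℓ - 2) / 2 + 1` vertices of a broom-free graph have few common neighbours. -/
lemma BroomFree.card_common_neighbors_lt {k : ℕ} (hG : BroomFree ℓ s G) (hk : 1 ≤ k)
    (hℓ : ℓ = 2 * k + 2) {S : Finset V} (hS : #S = k + 1) :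
    #{w | ∀ v ∈ S, G.Adj v w} < ℓ + s := by
  by_contra! hT
  obtain ⟨a, vs, hvs⟩ : ∃ a vs, S.toList = a :: vs :=
    List.exists_cons_of_ne_nil fun h => by simp [Finset.toList_eq_nil.1 h] at hS
  have hmem (x : V) : x ∈ a :: vs ↔ x ∈ S := by rw [← hvs, Finset.mem_toList]
  have hlen : (a :: vs).length = k + 1 := by rw [← hvs, Finset.length_toList, hS]
  obtain ⟨l, h1, h2, h3, -, c, hc, h4⟩ := exists_alternating_path (G := G) (T := ℓ + s) vs a ∅
    (hvs ▸ S.nodup_toList)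
    (fun x hx y hy _ => hT.trans (Finset.card_le_card fun w hw => by
      have hw' := (Finset.mem_filter.1 hw).2
      simpa using ⟨hw' x ((hmem x).1 hx), hw' y ((hmem y).1 hy)⟩))
    (by simp) (by rw [hlen, Finset.card_empty]; omega)
  simp only [List.length_cons] at hlen
  have hlt := hG.degree_lt_of_path (by omega) (by simp only [List.length_cons]; omega) h1 h2 h4
  have hle : #{w | ∀ v ∈ S, G.Adj v w} ≤ G.degree c := by
    rw [← G.card_neighborFinset_eq_degree]
    exact Finset.card_le_card fun w hw => by
      simpa using (Finset.mem_filter.1 hw).2 c ((hmem c).1 hc)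
  omega

/-- If the vertices of `K` pairwise have many common neighbours, then a neighbour of `K` outside
`K` has no neighbour outside `K`. -/
lemma BroomFree.not_adj_of_adj {k : ℕ} (hG : BroomFree ℓ s G) (hk : 1 ≤ k)
    (hℓ : ℓ = 2 * k + 2) {K : Finset V} (hK : #K = k)
    (hdeg : ∀ v ∈ K, ℓ + s ≤ G.degree v)
    (hcodeg : ∀ u ∈ K, ∀ v ∈ K, u ≠ v →
      ℓ + s ≤ #(G.neighborFinset u ∩ G.neighborFinset v))
    {v y x : V} (hv : v ∈ K) (hy : y ∉ K) (hx : x ∉ K) (hvy : G.Adj v y) : ¬ G.Adj y x := by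
  intro hyx
  have hmem (z : V) : z ∈ v :: (K.erase v).toList ↔ z ∈ K := by
    rw [List.mem_cons, Finset.mem_toList, Finset.mem_erase]
    by_cases h : z = v <;> simp [h, hv]
  have hlen : (K.erase v).toList.length = k - 1 := by
    rw [Finset.length_toList, Finset.card_erase_of_mem hv, hK]
  obtain ⟨l, h1, h2, h3, h4, c, hc, h5⟩ := exists_alternating_path (G := G) (T := ℓ + s)
    (K.erase v).toList v {y, x}
    (List.nodup_cons.2 ⟨by simp, Finset.nodup_toList _⟩)
    (fun a ha b hb => hcodeg a ((hmem a).1 ha) b ((hmem b).1 hb))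
    (fun z hz hz' => by
      rw [hmem] at hz
      rcases Finset.mem_insert.1 hz' with rfl | hz'
      · exact hy hz
      · exact hx (Finset.mem_singleton.1 hz' ▸ hz))
    (by
      have := Finset.card_le_two (a := y) (b := x)
      rw [List.length_cons, hlen]
      omega)
  have hyl : y ∉ v :: l := fun h => h4 y h (by simp)
  have hxl : x ∉ v :: l := fun h => h4 x h (by simp)
  have hlt := hG.degree_lt_of_path (l := x :: y :: v :: l) (c := c) (by omega)
    (by simp only [List.length_cons]; omega)
    (List.isChain_cons_cons.2 ⟨hyx.symm, List.isChain_cons_cons.2 ⟨hvy.symm, h1⟩⟩)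
    (List.nodup_cons.2 ⟨by
      rw [List.mem_cons, not_or]
      exact ⟨hyx.ne', hxl⟩, List.nodup_cons.2 ⟨hyl, h2⟩⟩)
    (by rw [List.getLast?_cons_cons, List.getLast?_cons_cons, h5])
  exact absurd (hdeg c ((hmem c).1 hc)) (by omega)

end Broom

/-- A broom-free graph on `n` vertices, `n` large, whose degree square sum is at least
`k * (n - 1) ^ 2` has `k` vertices of almost full degree. -/
lemma exists_large_degree_set {ℓ s k : ℕ} (hk : 1 ≤ k) (hℓ : ℓ = 2 * k + 2) (p : ℕ) (hp : 2 ≤ p) :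
    ∃ N : ℕ, ∀ n : ℕ, N ≤ n → ∀ G : SimpleGraph (Fin n), BroomFree ℓ s G →
      k * (n - 1) ^ 2 ≤ ∑ v, G.degree v ^ 2 →
      ∃ K : Finset (Fin n), #K = k ∧ ∀ v ∈ K, (p - 1) * n ≤ p * G.degree v := by
  obtain ⟨t, ht⟩ : ∃ t, t = ℓ + s := ⟨_, rfl⟩
  obtain ⟨M, hM⟩ : ∃ M, M = 2 * p * (2 * t) * (2 * t) := ⟨_, rfl⟩
  obtain ⟨B, hB⟩ : ∃ B, B = 2 ^ M * t * M := ⟨_, rfl⟩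
  refine ⟨2 * p * (B + 2 * k) + 1, fun n hn G hG hsum => ?_⟩
  have htot : ∑ v, G.degree v ≤ 2 * t * n := by
    have h := hG.sum_card_filter_adj_le (by omega) Finset.univ
    rw [Finset.card_univ, Fintype.card_fin, ← ht] at h
    refine le_trans (le_of_eq (Finset.sum_congr rfl fun v _ => ?_)) h
    rw [← G.card_neighborFinset_eq_degree, G.neighborFinset_eq_filter]
  have hdlt (v : Fin n) : G.degree v ≤ n := by
    simpa using (G.degree_lt_card_verts v).le
  obtain ⟨q, hq⟩ : ∃ q, q = 2 * p * (2 * t) := ⟨_, rfl⟩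
  obtain ⟨L, hL⟩ : ∃ L : Finset (Fin n), L =
      ({v | n ≤ q * G.degree v} : Finset (Fin n)) := ⟨_, rfl⟩
  have hLmem (v : Fin n) : v ∈ L ↔ n ≤ q * G.degree v := by simp [hL]
  have hLcard : #L ≤ M := by
    have h1 : #L * n ≤ ∑ v ∈ L, q * G.degree v := by
      rw [← smul_eq_mul]
      exact Finset.card_nsmul_le_sum _ _ _ fun v hv => (hLmem v).1 hv
    have h2 : ∑ v ∈ L, q * G.degree v ≤ q * (2 * t * n) := by
      rw [← Finset.mul_sum]
      exact Nat.mul_le_mul_left _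
        ((Finset.sum_le_sum_of_subset (Finset.subset_univ L)).trans htot)
    have h3 : #L * n ≤ M * n := by
      calc #L * n ≤ q * (2 * t * n) := h1.trans h2
        _ = M * n := by rw [hM, hq]; ring
    exact Nat.le_of_mul_le_mul_right h3 (by omega)
  have hbad : #{w | k + 1 ≤ #{v ∈ L | G.Adj v w}} ≤ 2 ^ M * t := by
    have hsub : ({w | k + 1 ≤ #{v ∈ L | G.Adj v w}} : Finset (Fin n)) ⊆
        (L.powersetCard (k + 1)).biUnion fun S => {w | ∀ v ∈ S, G.Adj v w} := by
      intro w hw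
      obtain ⟨S, hS, hScard⟩ := Finset.exists_subset_card_eq (Finset.mem_filter.1 hw).2
      rw [Finset.mem_biUnion]
      refine ⟨S, Finset.mem_powersetCard.2 ⟨hS.trans (Finset.filter_subset _ _), hScard⟩, ?_⟩
      simpa using fun v hv => (Finset.mem_filter.1 (hS hv)).2
    have hpow : #(L.powersetCard (k + 1)) ≤ 2 ^ M := by
      rw [Finset.card_powersetCard]
      exact (Nat.choose_le_two_pow _ _).trans (Nat.pow_le_pow_right (by norm_num) hLcard)
    refine (Finset.card_le_card hsub).trans ((Finset.card_biUnion_le_card_mul _ _ t ?_).trans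
      (Nat.mul_le_mul_right _ hpow))
    intro S hS
    rw [ht]
    refine Nat.le_of_lt ?_
    convert hG.card_common_neighbors_lt hk hℓ (Finset.mem_powersetCard.1 hS).2
  have hLsum : ∑ v ∈ L, G.degree v ≤ k * n + B := by
    have h1 : ∑ v ∈ L, G.degree v = ∑ w, #{v ∈ L | G.Adj v w} := by
      simp_rw [← G.card_neighborFinset_eq_degree, G.neighborFinset_eq_filter, Finset.card_filter]
      rw [Finset.sum_comm]
    have h2 : ∀ w ∈ Finset.univ, #{v ∈ L | G.Adj v w} ≤
        k + if k + 1 ≤ #{v ∈ L | G.Adj v w} then M else 0 := by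
      intro w _
      split_ifs with h
      · exact ((Finset.card_filter_le _ _).trans hLcard).trans (Nat.le_add_left _ _)
      · omega
    rw [h1]
    refine (Finset.sum_le_sum h2).trans ?_
    rw [Finset.sum_add_distrib, ← Finset.sum_filter, Finset.sum_const, Finset.sum_const,
      Finset.card_univ, Fintype.card_fin, smul_eq_mul, smul_eq_mul, hB, mul_comm n k]
    exact Nat.add_le_add_left (Nat.mul_le_mul_right _ hbad) _
  by_contra! hcon
  obtain ⟨A, hA⟩ : ∃ A : Finset (Fin n), A =
      ({v ∈ L | (p - 1) * n ≤ p * G.degree v} : Finset (Fin n)) := ⟨_, rfl⟩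
  have hAcard : #A + 1 ≤ k := by
    by_contra! h
    obtain ⟨K, hKA, hK⟩ := Finset.exists_subset_card_eq (show k ≤ #A by omega)
    obtain ⟨v, hv, hv'⟩ := hcon K hK
    have := hKA hv
    rw [hA, Finset.mem_filter] at this
    omega
  have hn0 : 0 < n := by omega
  have hnR : (0 : ℝ) < n := by exact_mod_cast hn0
  have hpR : (2 : ℝ) ≤ p := by exact_mod_cast hp
  have hp1 : ((p - 1 : ℕ) : ℝ) = p - 1 := by push_cast [Nat.cast_sub (show 1 ≤ p by omega)]; ring
  have htR : (0 : ℝ) < t := by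
    have : 0 < t := by omega
    exact_mod_cast this
  have hsumL : (∑ v ∈ L, (G.degree v : ℝ)) ≤ k * n + B := by exact_mod_cast hLsum
  have hout : (p : ℝ) * 2 * ∑ v ∈ Lᶜ, (G.degree v : ℝ) ^ 2 ≤ n ^ 2 := by
    have h1 : ∀ v ∈ Lᶜ, (q : ℝ) * (G.degree v : ℝ) ^ 2 ≤ n * G.degree v := by
      intro v hv
      rw [Finset.mem_compl, hLmem, not_le] at hv
      have hv' : (q : ℝ) * G.degree v ≤ n := by exact_mod_cast hv.le
      have := mul_le_mul_of_nonneg_right hv' (Nat.cast_nonneg (α := ℝ) (G.degree v))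
      linarith
    have h2 := Finset.sum_le_sum h1
    rw [← Finset.mul_sum, ← Finset.mul_sum] at h2
    have h3 : (∑ v ∈ Lᶜ, (G.degree v : ℝ)) ≤ 2 * t * n := by
      refine (Finset.sum_le_sum_of_subset_of_nonneg (Finset.subset_univ _)
        (fun _ _ _ => Nat.cast_nonneg _)).trans ?_
      exact_mod_cast htot
    have h4 := h2.trans (mul_le_mul_of_nonneg_left h3 hnR.le)
    rw [hq] at h4
    push_cast at h4
    have h5 : (2 * t : ℝ) * (p * 2 * ∑ v ∈ Lᶜ, (G.degree v : ℝ) ^ 2) ≤ 2 * t * n ^ 2 := by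
      linarith
    exact le_of_mul_le_mul_left h5 (by positivity)
  have hin : (p : ℝ) * ∑ v ∈ L, (G.degree v : ℝ) ^ 2 ≤
      (k - 1) * n ^ 2 + (p - 1) * n * (k * n + B) := by
    have h1 : ∀ v ∈ L, (p : ℝ) * (G.degree v : ℝ) ^ 2 - (p - 1) * n * G.degree v ≤
        if (p - 1) * n ≤ p * G.degree v then (n : ℝ) ^ 2 else 0 := by
      intro v hv
      have hd : (G.degree v : ℝ) ≤ n := by exact_mod_cast hdlt v
      have hd0 : (0 : ℝ) ≤ G.degree v := Nat.cast_nonneg _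
      split_ifs with h
      · have hh : (p - 1 : ℝ) * n ≤ p * G.degree v := by rw [← hp1]; exact_mod_cast h
        nlinarith [mul_nonneg (sub_nonneg.2 hd) hd0, mul_nonneg (sub_nonneg.2 hd) hnR.le,
          mul_nonneg (sub_nonneg.2 hh) (sub_nonneg.2 hd),
          mul_nonneg (mul_nonneg (sub_nonneg.2 hd) hd0) (show (0 : ℝ) ≤ p by linarith)]
      · have hh : p * (G.degree v : ℝ) ≤ (p - 1) * n := by
          rw [← hp1]; exact_mod_cast (not_le.1 h).le
        nlinarith [mul_nonneg (sub_nonneg.2 hh) hd0]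
    have h2 := Finset.sum_le_sum h1
    rw [Finset.sum_sub_distrib, ← Finset.mul_sum, ← Finset.mul_sum, ← Finset.sum_filter,
      ← hA, Finset.sum_const, nsmul_eq_mul] at h2
    have hA' : (#A : ℝ) ≤ k - 1 := by
      have : (#A : ℝ) + 1 ≤ k := by exact_mod_cast hAcard
      linarith
    have h3 := mul_le_mul_of_nonneg_right hA' (sq_nonneg (n : ℝ))
    have h4 := mul_le_mul_of_nonneg_left hsumL
      (mul_nonneg (show (0 : ℝ) ≤ p - 1 by linarith) hnR.le)
    linarith
  have hall : (k : ℝ) * (n - 1) ^ 2 ≤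
      ∑ v ∈ L, (G.degree v : ℝ) ^ 2 + ∑ v ∈ Lᶜ, (G.degree v : ℝ) ^ 2 := by
    rw [Finset.sum_add_sum_compl]
    have : ((k * (n - 1) ^ 2 : ℕ) : ℝ) ≤ (∑ v, G.degree v ^ 2 : ℕ) := by exact_mod_cast hsum
    push_cast [Nat.cast_sub (show 1 ≤ n from hn0)] at this
    exact this
  have hnN : (2 : ℝ) * p * (B + 2 * k) + 1 ≤ n := by exact_mod_cast hn
  have hkR : (1 : ℝ) ≤ k := by exact_mod_cast hk
  have hBR : (0 : ℝ) ≤ B := Nat.cast_nonneg _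
  have hmul := mul_le_mul_of_nonneg_left hall (show (0 : ℝ) ≤ 2 * p by linarith)
  have hfin : (n : ℝ) * n ≤ n * (2 * p * (B + 2 * k)) := by
    have e1 : 0 ≤ (p : ℝ) * k := by positivity
    have e2 : 0 ≤ (n : ℝ) * B := by positivity
    nlinarith
  have := le_of_mul_le_mul_left hfin hnR
  linarith

/-- The degree power sum of the join of a complete graph on `K` and an empty graph. -/
lemma sum_degree_pow_of_adj_iff {n k r : ℕ} {G : SimpleGraph (Fin n)} {K : Finset (Fin n)}
    (hK : #K = k) (hadj : ∀ u v, G.Adj u v ↔ u ≠ v ∧ (u ∈ K ∨ v ∈ K)) :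
    ∑ v, G.degree v ^ r = k * (n - 1) ^ r + (n - k) * k ^ r := by
  rw [← Finset.sum_add_sum_compl K]
  congr 1
  · rw [← hK, ← smul_eq_mul]
    refine Finset.sum_eq_card_nsmul fun v hv => ?_
    rw [← G.card_neighborFinset_eq_degree]
    have : G.neighborFinset v = Finset.univ.erase v := by
      ext w
      simp [hadj, hv, eq_comm]
    rw [this, Finset.card_erase_of_mem (Finset.mem_univ v), Finset.card_univ, Fintype.card_fin]
  · have hc : #Kᶜ = n - k := by rw [Finset.card_compl, Fintype.card_fin, hK]
    rw [← hc, ← smul_eq_mul]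
    refine Finset.sum_eq_card_nsmul fun v hv => ?_
    rw [Finset.mem_compl] at hv
    rw [← G.card_neighborFinset_eq_degree]
    have : G.neighborFinset v = K := by
      ext w
      rw [mem_neighborFinset, hadj]
      constructor
      · rintro ⟨-, h | h⟩
        · exact absurd h hv
        · exact h
      · exact fun h => ⟨fun h' => hv (h' ▸ h), Or.inr h⟩
    rw [this, hK]

lemma Hgraph_adj {k n : ℕ} (u v : Fin n) :
    (Hgraph k n).Adj u v ↔ u ≠ v ∧ (u.val < k ∨ v.val < k) := by
  rw [Hgraph, SimpleGraph.fromRel_adj]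
  tauto

lemma card_filter_val_lt {k n : ℕ} (h : k ≤ n) : #{v : Fin n | v.val < k} = k := by
  rw [Fin.card_filter_val_lt, min_eq_right h]

lemma sum_degree_pow_of_iso_Hgraph {n k r : ℕ} (hkn : k ≤ n) {G : SimpleGraph (Fin n)}
    (φ : G ≃g Hgraph k n) : ∑ v, G.degree v ^ r = k * (n - 1) ^ r + (n - k) * k ^ r := by
  rw [← sum_degree_pow_of_adj_iff (G := Hgraph k n) (r := r) (card_filter_val_lt hkn)
    (by simp [Hgraph_adj]),
    ← Equiv.sum_comp φ.toEquiv fun v => (Hgraph k n).degree v ^ r]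
  exact Finset.sum_congr rfl fun v _ => by
    rw [← φ.degree_eq v]
    rfl

lemma nonempty_iso_Hgraph {n k : ℕ} {G : SimpleGraph (Fin n)} {K : Finset (Fin n)}
    (hK : #K = k) (hadj : ∀ u v, G.Adj u v ↔ u ≠ v ∧ (u ∈ K ∨ v ∈ K)) :
    Nonempty (G ≃g Hgraph k n) := by
  have hkn : k ≤ n := by simpa [hK] using Finset.card_le_univ K
  have hcard : Fintype.card {v // v ∈ K} = Fintype.card {v : Fin n // v.val < k} := by
    rw [Fintype.card_coe, hK, Fintype.card_subtype, card_filter_val_lt hkn]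
  let e := Fintype.equivOfCardEq hcard
  have he (v : Fin n) : (e.extendSubtype v).val < k ↔ v ∈ K :=
    ⟨fun h => by_contra fun h' => e.extendSubtype_not_mem v h' h, e.extendSubtype_mem v⟩
  refine ⟨⟨e.extendSubtype, ?_⟩⟩
  intro u v
  rw [Hgraph_adj, hadj, he, he, e.extendSubtype.injective.ne_iff]

/-- If `k` vertices of a large broom-free graph have almost full degree and the degree power sum
is at least that of `Hgraph k n`, then the graph is the join of a clique of size `k` and an empty
graph. -/
lemma BroomFree.adj_iff_of_large_degree {ℓ s k r n p : ℕ} (hk : 1 ≤ k) (hℓ : ℓ = 2 * k + 2)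
    (hr : 2 ≤ r) {G : SimpleGraph (Fin n)} (hG : BroomFree ℓ s G)
    (hp : p = 2 * (2 * (ℓ + s) + 1)) (hn : 2 * (ℓ + s) ≤ n)
    {K : Finset (Fin n)} (hK : #K = k) (hdeg : ∀ v ∈ K, (p - 1) * n ≤ p * G.degree v)
    (hsum : k * (n - 1) ^ r + (n - k) * k ^ r ≤ ∑ v, G.degree v ^ r) (u v : Fin n) :
    G.Adj u v ↔ u ≠ v ∧ (u ∈ K ∨ v ∈ K) := by
  obtain ⟨t, ht⟩ : ∃ t, t = ℓ + s := ⟨_, rfl⟩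
  rw [← ht] at hn hp
  have hdlt (v : Fin n) : G.degree v ≤ n - 1 := by
    have := G.degree_lt_card_verts v
    rw [Fintype.card_fin] at this
    omega
  have hdeg' (v : Fin n) (hv : v ∈ K) :
      p * (n - G.degree v) ≤ n := by
    have h1 := hdeg v hv
    obtain ⟨c, rfl⟩ : ∃ c, p = c + 1 := ⟨p - 1, by omega⟩
    rw [Nat.add_sub_cancel] at h1
    rw [Nat.mul_sub, Nat.succ_mul c n]
    omega
  have hbig (v : Fin n) (hv : v ∈ K) : 4 * (n - G.degree v) ≤ n :=
    (Nat.mul_le_mul_right _ (by omega)).trans (hdeg' v hv)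
  have hnot {v y x : Fin n} := hG.not_adj_of_adj (v := v) (y := y) (x := x) hk hℓ hK
    (fun v hv => by
      have := hbig v hv
      omega)
    (fun u hu v hv _ => by
      have h1 := Finset.card_union_add_card_inter (G.neighborFinset u) (G.neighborFinset v)
      have h2 := Finset.card_le_univ (G.neighborFinset u ∪ G.neighborFinset v)
      rw [Fintype.card_fin] at h2
      rw [G.card_neighborFinset_eq_degree, G.card_neighborFinset_eq_degree] at h1
      have h3 := hbig u hu
      have h4 := hbig v hv
      omega)
  obtain ⟨Z, hZ⟩ : ∃ Z : Finset (Fin n), Z = ({z ∈ Kᶜ | ∀ v ∈ K, ¬ G.Adj v z} : Finset (Fin n)) :=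
    ⟨_, rfl⟩
  have hZK (z : Fin n) (hz : z ∈ Z) : z ∉ K ∧ ∀ v ∈ K, ¬ G.Adj v z := by simpa [hZ] using hz
  have hZsub : Z ⊆ Kᶜ := hZ ▸ Finset.filter_subset _ _
  have hYadj (y : Fin n) (hy : y ∉ K) (hyZ : y ∉ Z) (x : Fin n) (h : G.Adj y x) : x ∈ K := by
    have : ∃ v ∈ K, G.Adj v y := by
      by_contra! hcon
      exact hyZ (by simpa [hZ] using ⟨hy, hcon⟩)
    obtain ⟨v, hv, hvy⟩ := this
    by_contra hx
    exact hnot hv hy hx hvy h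
  have hZadj (z : Fin n) (hz : z ∈ Z) (x : Fin n) (h : G.Adj z x) : x ∈ Z := by
    by_contra hx
    by_cases hxK : x ∈ K
    · exact (hZK z hz).2 x hxK h.symm
    · exact (hZK z hz).1 (hYadj x hxK hx z h.symm)
  have hdegZ (z : Fin n) (hz : z ∈ Z) : G.degree z ≤ #Z := by
    rw [← G.card_neighborFinset_eq_degree]
    exact Finset.card_le_card fun x hx => hZadj z hz x (by simpa using hx)
  have hdegK (v : Fin n) (hv : v ∈ K) : G.degree v + #Z ≤ n - 1 := by
    have hdisj : Disjoint (G.neighborFinset v) Z := by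
      rw [Finset.disjoint_left]
      intro z hz hz'
      exact (hZK z hz').2 v hv (by simpa using hz)
    rw [← G.card_neighborFinset_eq_degree, ← Finset.card_union_of_disjoint hdisj]
    have hsub : G.neighborFinset v ∪ Z ⊆ Finset.univ.erase v := by
      intro x hx
      rw [Finset.mem_erase]
      refine ⟨?_, Finset.mem_univ x⟩
      rintro rfl
      rcases Finset.mem_union.1 hx with h | h
      · simp at h
      · exact (hZK _ h).1 hv
    simpa using Finset.card_le_card hsub
  have hdegY (y : Fin n) (hy : y ∈ Kᶜ \ Z) : G.degree y ≤ k := by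
    rw [Finset.mem_sdiff, Finset.mem_compl] at hy
    rw [← G.card_neighborFinset_eq_degree, ← hK]
    exact Finset.card_le_card fun x hx => hYadj y hy.1 hy.2 x (by simpa using hx)
  have hsumZ : ∑ z ∈ Z, G.degree z ≤ 2 * t * #Z := by
    have h := hG.sum_card_filter_adj_le (by omega) Z
    rw [← ht] at h
    refine le_trans (Finset.sum_le_sum fun z hz => ?_) h
    rw [← G.card_neighborFinset_eq_degree]
    exact Finset.card_le_card fun x hx => Finset.mem_filter.2
      ⟨hZadj z hz x (by simpa using hx), by simpa using hx⟩
  have hsplit : ∑ v, G.degree v ^ r =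
      ∑ v ∈ K, G.degree v ^ r + (∑ v ∈ Kᶜ \ Z, G.degree v ^ r + ∑ v ∈ Z, G.degree v ^ r) := by
    rw [Finset.sum_sdiff hZsub, Finset.sum_add_sum_compl]
  have hY : ∑ v ∈ Kᶜ \ Z, G.degree v ^ r ≤ (n - k) * k ^ r := by
    have hc : #(Kᶜ \ Z) ≤ n - k := by
      refine (Finset.card_le_card Finset.sdiff_subset).trans ?_
      rw [Finset.card_compl, Fintype.card_fin, hK]
    refine le_trans ?_ (Nat.mul_le_mul_right _ hc)
    rw [← smul_eq_mul]
    exact Finset.sum_le_card_nsmul _ _ _ fun v hv => Nat.pow_le_pow_left (hdegY v hv) r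
  obtain ⟨v₀, hv₀⟩ : K.Nonempty := Finset.card_pos.1 (by omega)
  obtain ⟨m, rfl⟩ : ∃ m, r = m + 1 := ⟨r - 1, by omega⟩
  have hpow (a b : ℕ) (h : a + b ≤ n - 1) :
      a ^ (m + 1) + b * (n - 1) ^ m ≤ (n - 1) ^ (m + 1) := by
    calc a ^ (m + 1) + b * (n - 1) ^ m ≤ a * (n - 1) ^ m + b * (n - 1) ^ m := by
          rw [pow_succ']
          gcongr
          omega
      _ = (a + b) * (n - 1) ^ m := by ring
      _ ≤ (n - 1) * (n - 1) ^ m := Nat.mul_le_mul_right _ h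
      _ = (n - 1) ^ (m + 1) := by ring
  have hKsum : ∑ v ∈ K, G.degree v ^ (m + 1) + k * (#Z * (n - 1) ^ m) ≤ k * (n - 1) ^ (m + 1) := by
    rw [← hK, ← smul_eq_mul (#K), ← Finset.sum_const, ← Finset.sum_add_distrib,
      ← smul_eq_mul (#K)]
    exact Finset.sum_le_card_nsmul _ _ _ fun v hv => hpow _ _ (hdegK v hv)
  have hn1 : 0 < (n - 1) ^ m := Nat.pow_pos (by omega)
  have hZempty : Z = ∅ := by
    by_contra hne
    have hZpos : 0 < #Z := Finset.card_pos.2 (Finset.nonempty_iff_ne_empty.2 hne)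
    have hZn : (2 * t + 1) * #Z ≤ n - 1 := by
      have h1 := hdeg' v₀ hv₀
      have h2 : p * #Z ≤ p * (n - G.degree v₀) :=
        Nat.mul_le_mul_left _ (by have := hdegK v₀ hv₀; omega)
      have h3 : p * #Z = 2 * ((2 * t + 1) * #Z) := by rw [hp]; ring
      omega
    have hZsum : (2 * t + 1) * ∑ v ∈ Z, G.degree v ^ (m + 1) ≤
        2 * t * (#Z * (n - 1) ^ m) := by
      have h1 : ∑ v ∈ Z, G.degree v ^ (m + 1) ≤ #Z ^ m * (2 * t * #Z) := by
        refine le_trans ?_ (Nat.mul_le_mul_left _ hsumZ)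
        rw [Finset.mul_sum]
        refine Finset.sum_le_sum fun z hz => ?_
        rw [pow_succ]
        exact Nat.mul_le_mul_right _ (Nat.pow_le_pow_left (hdegZ z hz) m)
      have h2 : (2 * t + 1) * #Z ^ m ≤ (n - 1) ^ m := by
        refine le_trans ?_ (Nat.pow_le_pow_left hZn m)
        rw [mul_pow]
        exact Nat.mul_le_mul_right _ (Nat.le_self_pow (by omega) _)
      calc (2 * t + 1) * ∑ v ∈ Z, G.degree v ^ (m + 1)
          ≤ (2 * t + 1) * (#Z ^ m * (2 * t * #Z)) := Nat.mul_le_mul_left _ h1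
        _ = ((2 * t + 1) * #Z ^ m) * (2 * t * #Z) := by ring
        _ ≤ (n - 1) ^ m * (2 * t * #Z) := Nat.mul_le_mul_right _ h2
        _ = 2 * t * (#Z * (n - 1) ^ m) := by ring
    have hpos : 0 < #Z * (n - 1) ^ m := Nat.mul_pos hZpos hn1
    have hge : #Z * (n - 1) ^ m ≤ k * (#Z * (n - 1) ^ m) := Nat.le_mul_of_pos_left _ hk
    have hle : #Z * (n - 1) ^ m ≤ ∑ v ∈ Z, G.degree v ^ (m + 1) := by omega
    have := (Nat.mul_le_mul_left (2 * t + 1) hle).trans hZsum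
    nlinarith
  have hKdeg (v : Fin n) (hv : v ∈ K) : G.degree v = n - 1 := by
    by_contra hne
    have hlt : ∑ v ∈ K, G.degree v ^ (m + 1) < ∑ v ∈ K, (n - 1) ^ (m + 1) :=
      Finset.sum_lt_sum (fun w _ => Nat.pow_le_pow_left (hdlt w) _)
        ⟨v, hv, Nat.pow_lt_pow_left (lt_of_le_of_ne (hdlt v) hne) (by omega)⟩
    rw [Finset.sum_const, smul_eq_mul, hK] at hlt
    rw [hZempty, Finset.sum_empty] at hsplit
    rw [hZempty] at hY
    omega
  have hKadj (v : Fin n) (hv : v ∈ K) (w : Fin n) (hne : v ≠ w) : G.Adj v w := by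
    have hsub : G.neighborFinset v ⊆ Finset.univ.erase v := by
      intro x hx
      rw [mem_neighborFinset] at hx
      exact Finset.mem_erase.2 ⟨hx.ne', Finset.mem_univ x⟩
    have heq := Finset.eq_of_subset_of_card_le hsub (by
      rw [G.card_neighborFinset_eq_degree, hKdeg v hv]
      simp)
    rw [← mem_neighborFinset, heq]
    exact Finset.mem_erase.2 ⟨hne.symm, Finset.mem_univ w⟩
  constructor
  · intro h
    refine ⟨h.ne, ?_⟩
    by_contra! hcon
    exact hcon.2 (hYadj u hcon.1 (by simp [hZempty]) v h)
  · rintro ⟨hne, h | h⟩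
    · exact hKadj u h v hne
    · exact (hKadj v h u hne.symm).symm

/-- For even `ℓ ≥ 4`, `k = (ℓ-2)/2`, `r ≥ 2` and all sufficiently large `n`, every
`n`-vertex `B(ℓ,s)`-free graph `G` satisfies `e_r(G) ≤ k(n-1)^r + (n-k)k^r`, with
equality iff `G ≅ H(k,n)`. -/
theorem er_extremal_broom_even (ℓ s k r : ℕ) (hℓ : 4 ≤ ℓ) (heven : Even ℓ)
    (hk : k = (ℓ - 2) / 2) (hr : 2 ≤ r) :
    ∃ N : ℕ, ∀ n : ℕ, N ≤ n → ∀ G : SimpleGraph (Fin n), BroomFree ℓ s G →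
      (∑ v : Fin n, G.degree v ^ r ≤ k * (n - 1) ^ r + (n - k) * k ^ r) ∧
      ((∑ v : Fin n, G.degree v ^ r = k * (n - 1) ^ r + (n - k) * k ^ r) ↔
        Nonempty (G ≃g Hgraph k n)) := by
  obtain ⟨j, hj⟩ := heven
  have hk1 : 1 ≤ k := by omega
  have hℓk : ℓ = 2 * k + 2 := by omega
  obtain ⟨N, hN⟩ := exists_large_degree_set (s := s) hk1 hℓk (2 * (2 * (ℓ + s) + 1)) (by omega)
  refine ⟨max N (2 * (ℓ + s)), fun n hn G hG => ?_⟩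
  have hkn : k ≤ n := by omega
  by_cases hsum : k * (n - 1) ^ r + (n - k) * k ^ r ≤ ∑ v : Fin n, G.degree v ^ r
  · have hsq : k * (n - 1) ^ 2 ≤ ∑ v, G.degree v ^ 2 := by
      have h1 : ∑ v, G.degree v ^ r ≤ (n - 1) ^ (r - 2) * ∑ v, G.degree v ^ 2 := by
        rw [Finset.mul_sum]
        refine Finset.sum_le_sum fun v _ => ?_
        have hd : G.degree v ≤ n - 1 := by
          have := G.degree_lt_card_verts v
          rw [Fintype.card_fin] at this
          omega
        calc G.degree v ^ r = G.degree v ^ (r - 2) * G.degree v ^ 2 := by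
              rw [← pow_add]
              congr 1
              omega
          _ ≤ _ := Nat.mul_le_mul_right _ (Nat.pow_le_pow_left hd _)
      have h2 : (n - 1) ^ (r - 2) * (k * (n - 1) ^ 2) = k * (n - 1) ^ r := by
        rw [mul_left_comm, ← pow_add]
        congr 2
        omega
      refine Nat.le_of_mul_le_mul_left (c := (n - 1) ^ (r - 2)) ?_ (Nat.pow_pos (by omega))
      omega
    obtain ⟨K, hK, hdeg⟩ := hN n (by omega) G hG hsq
    have hadj := hG.adj_iff_of_large_degree hk1 hℓk hr rfl (by omega) hK hdeg hsum
    have heq := sum_degree_pow_of_adj_iff (r := r) hK hadj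
    exact ⟨heq.le, fun _ => nonempty_iso_Hgraph hK hadj, fun _ => heq⟩
  · refine ⟨(not_le.1 hsum).le, fun h => absurd h.ge hsum, fun ⟨φ⟩ => ?_⟩
    exact sum_degree_pow_of_iso_Hgraph hkn φ
end

section
/- Let ℓ ≥ 7 be odd, s ≥ 0, k = (ℓ−3)/2, and r ≥ 2. For all sufficiently large n, every n-vertex B(ℓ,s)-free graph G satisfies e_r(G) ≤ e_r(H*(k,n)) = k(n−1)^r + 2(k+1)^r + (n−k−2)k^r, with equality if and only if G is isomorphic to H*(k,n). -/
open scoped Classical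
open Finset SimpleGraph

/-- `H*(k,n)`: `H(k,n)` together with one extra edge (between `k` and `k+1`) inside
the part of size `n-k`. -/
noncomputable def HstarGraph (k n : ℕ) : SimpleGraph (Fin n) :=
  SimpleGraph.fromRel (fun a b => a.val < k ∨ b.val < k ∨ (a.val = k ∧ b.val = k + 1))

/-- A path whose second vertex has large degree extends to a broom. -/
lemma not_broomFree_of_isChain {V : Type*} [Fintype V] {G : SimpleGraph V} {ℓ s : ℕ} {w h : V}
    {q : List V} (hc : (w :: h :: q).IsChain G.Adj) (hn : (w :: h :: q).Nodup)
    (hl : q.length + 2 = ℓ) (hd : ℓ + s ≤ G.degree h) : ¬ BroomFree ℓ s G := by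
  obtain ⟨p, hp⟩ : ∃ p, p = w :: h :: q := ⟨_, rfl⟩
  have hpl : p.length = ℓ := by simp [hp, ← hl]
  have hcard : s ≤ #(G.neighborFinset h \ p.toFinset) := by
    have h1 := Finset.le_card_sdiff p.toFinset (G.neighborFinset h)
    have h2 := p.toFinset_card_le
    rw [G.card_neighborFinset_eq_degree] at h1
    omega
  obtain ⟨t, ht, hts⟩ := Finset.exists_subset_card_eq hcard
  let e : Fin s ≃ t := (Finset.equivFinOfCardEq hts).symm
  have he : ∀ i, G.Adj h (e i) ∧ (e i : V) ∉ p := fun i => by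
    simpa using ht (e i).2
  rw [← hp] at hc hn
  let f : Fin (ℓ + s) → V := fun i =>
    if hi : i.val < ℓ then p[ℓ - 1 - i.val]'(by omega) else e ⟨i.val - ℓ, by omega⟩
  have hf : ∀ a b : Fin (ℓ + s),
      ((a.val + 1 = b.val ∧ b.val < ℓ) ∨ (a.val = ℓ - 2 ∧ ℓ ≤ b.val)) → G.Adj (f a) (f b) := by
    rintro a b (⟨hab, hb⟩ | ⟨ha, hb⟩)
    · have := List.isChain_iff_getElem.1 hc (ℓ - 1 - b.val) (by omega)
      simp only [f, dif_pos hb, dif_pos (show a.val < ℓ by omega)]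
      have h3 : ℓ - 1 - a.val = ℓ - 1 - b.val + 1 := by omega
      simp only [h3]
      exact this.symm
    · simp only [f, dif_neg (not_lt.2 hb), dif_pos (show a.val < ℓ by omega)]
      have h3 : ℓ - 1 - a.val = 1 := by omega
      simp only [h3]
      convert (he ⟨b.val - ℓ, by omega⟩).1
      simp [hp]
  refine not_not.2 ⟨⟨f, fun {a b} hab => ?_⟩, fun a b hab => ?_⟩
  · rcases (SimpleGraph.fromRel_adj _ _ _).1 hab with ⟨-, h | h⟩
    · exact hf _ _ h
    · exact (hf _ _ h).symm
  · change f a = f b at hab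
    by_cases ha : a.val < ℓ <;> by_cases hb : b.val < ℓ
    · simp only [f, dif_pos ha, dif_pos hb] at hab
      rw [hn.getElem_inj_iff] at hab
      ext; omega
    · simp only [f, dif_pos ha, dif_neg hb] at hab
      exact absurd (hab ▸ List.getElem_mem _) (he _).2
    · simp only [f, dif_neg ha, dif_pos hb] at hab
      exact absurd (hab ▸ List.getElem_mem _) (he _).2
    · simp only [f, dif_neg ha, dif_neg hb] at hab
      have := e.injective (Subtype.ext hab)
      simp only [Fin.mk.injEq] at this
      ext; omega

/-- A path ending at a vertex adjacent to all of `A` can be continued by alternating between `A`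
and the common neighbourhood `W`, which yields a broom if the total length is right. -/
lemma not_broomFree_of_hubs {V : Type*} [Fintype V] {G : SimpleGraph V} {ℓ s : ℕ} {W : Finset V}
    (hW : ℓ + s ≤ #W) {A : Finset V} (hA : A.Nonempty) (hAW : ∀ a ∈ A, ∀ w ∈ W, G.Adj a w)
    {x : V} {q : List V} (hx : ∀ a ∈ A, G.Adj x a) (hc : (x :: q).IsChain G.Adj)
    (hn : (x :: q).Nodup) (hd : ∀ a ∈ A, a ∉ x :: q) (hl : q.length + 1 + 2 * #A = ℓ) :
    ¬ BroomFree ℓ s G := by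
  induction A using Finset.induction_on generalizing x q with
  | empty => simp at hA
  | insert a A ha ih =>
    rw [Finset.card_insert_of_notMem ha] at hl
    obtain ⟨w, hw, hwq⟩ : ∃ w ∈ W, w ∉ (x :: q).toFinset := by
      refine Finset.exists_mem_notMem_of_card_lt_card ?_
      have := (x :: q).toFinset_card_le
      simp only [List.length_cons] at this
      omega
    rw [List.mem_toFinset] at hwq
    have haw := hAW a (by simp) w hw
    have hc' : (w :: a :: x :: q).IsChain G.Adj :=
      List.isChain_cons_cons.2 ⟨haw.symm, List.isChain_cons_cons.2 ⟨(hx a (by simp)).symm, hc⟩⟩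
    have hn' : (w :: a :: x :: q).Nodup := by
      refine List.nodup_cons.2 ⟨?_, List.nodup_cons.2 ⟨hd a (by simp), hn⟩⟩
      rw [List.mem_cons, not_or]
      exact ⟨haw.ne.symm, hwq⟩
    rcases A.eq_empty_or_nonempty with rfl | hA'
    · refine not_broomFree_of_isChain hc' hn' (by simp at hl ⊢; omega) (hW.trans ?_)
      rw [← G.card_neighborFinset_eq_degree]
      exact Finset.card_le_card fun v hv => by simpa using hAW a (by simp) v hv
    · refine ih hA' (fun b hb => hAW b (by simp [hb]))
        (fun b hb => (hAW b (by simp [hb]) w hw).symm) hc' hn' (fun b hb => ?_)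
        (by simp only [List.length_cons]; omega)
      rw [List.mem_cons, List.mem_cons, not_or, not_or]
      exact ⟨(hAW b (by simp [hb]) w hw).ne, fun h => ha (h ▸ hb), hd b (by simp [hb])⟩

/-- The number of neighbours of `v` in `S`. -/
noncomputable def degIn {V : Type*} (G : SimpleGraph V) (v : V) (S : Finset V) : ℕ :=
  #{u ∈ S | G.Adj v u}

lemma degIn_eq_sum {V : Type*} (G : SimpleGraph V) (v : V) (S : Finset V) :
    degIn G v S = ∑ u ∈ S, if G.Adj v u then 1 else 0 := Finset.card_filter _ _

lemma degIn_univ {V : Type*} [Fintype V] (G : SimpleGraph V) (v : V) :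
    degIn G v univ = G.degree v := by
  rw [← G.card_neighborFinset_eq_degree, degIn]
  congr 1
  ext; simp

lemma degIn_le_card {V : Type*} (G : SimpleGraph V) (v : V) (S : Finset V) :
    degIn G v S ≤ #S := Finset.card_filter_le _ _

lemma degIn_union {V : Type*} [DecidableEq V] (G : SimpleGraph V) (v : V) {S T : Finset V}
    (h : Disjoint S T) :
    degIn G v (S ∪ T) = degIn G v S + degIn G v T := by
  simp only [degIn_eq_sum, Finset.sum_union h]

lemma sum_degIn_comm {V : Type*} (G : SimpleGraph V) (S T : Finset V) :
    ∑ v ∈ S, degIn G v T = ∑ v ∈ T, degIn G v S := by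
  simp only [degIn_eq_sum]
  rw [Finset.sum_comm]
  simp only [G.adj_comm]

/-- A broom-free graph spans linearly many edges on every vertex set. -/
lemma BroomFree.sum_degIn_le {V : Type*} [Fintype V] {G : SimpleGraph V} {ℓ s : ℕ} (hℓ : 2 ≤ ℓ)
    (hG : BroomFree ℓ s G) (U : Finset V) :
    ∑ u ∈ U, degIn G u U ≤ 2 * (ℓ + s) * #U := by
  induction U using Finset.strongInduction with
  | H U ih =>
  rcases U.eq_empty_or_nonempty with rfl | hU
  · simp
  by_cases h : ∃ u ∈ U, degIn G u U < ℓ + s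
  · obtain ⟨u, hu, hlt⟩ := h
    have h1 := ih _ (Finset.erase_ssubset hu)
    have hself : degIn G u {u} = 0 := by simp [degIn]
    have hsplit : ∀ v, degIn G v U = degIn G v (U.erase u) + degIn G v {u} := fun v => by
      rw [← degIn_union G v (by simp)]
      congr 1
      ext x; simp only [Finset.mem_union, Finset.mem_erase, Finset.mem_singleton]
      by_cases hx : x = u <;> simp [hx, hu]
    have h2 : ∑ v ∈ U, degIn G v U =
        ∑ v ∈ U.erase u, degIn G v (U.erase u) + 2 * degIn G u U := by
      rw [← Finset.sum_erase_add _ _ hu, Finset.sum_congr rfl fun v _ => hsplit v,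
        Finset.sum_add_distrib, sum_degIn_comm G (U.erase u) {u}, Finset.sum_singleton, hsplit u,
        hself]
      ring
    have h3 := Finset.card_erase_add_one hu
    rw [h2, ← h3]
    nlinarith
  · push Not at h
    have hpath : ∀ m < ℓ, ∃ x ∈ U, ∃ q : List V, q.length = m ∧ (x :: q).IsChain G.Adj ∧
        (x :: q).Nodup ∧ ∀ y ∈ q, y ∈ U := by
      intro m
      induction m with
      | zero => exact fun _ => ⟨hU.choose, hU.choose_spec, [], by simp⟩
      | succ m ihm =>
        intro hm
        obtain ⟨x, hx, q, hq, hc, hn, hqU⟩ := ihm (by omega)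
        obtain ⟨y, hy, hyq⟩ : ∃ y ∈ ({u ∈ U | G.Adj x u} : Finset V), y ∉ (x :: q).toFinset := by
          refine Finset.exists_mem_notMem_of_card_lt_card ?_
          have h1 := (x :: q).toFinset_card_le
          have h2 := h x hx
          simp only [List.length_cons] at h1
          unfold degIn at h2
          omega
        rw [Finset.mem_filter] at hy
        rw [List.mem_toFinset] at hyq
        refine ⟨y, hy.1, x :: q, by simp [hq], List.isChain_cons_cons.2 ⟨hy.2.symm, hc⟩,
          List.nodup_cons.2 ⟨hyq, hn⟩, ?_⟩
        simpa [hx] using hqU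
    obtain ⟨x, hx, q, hq, hc, hn, hqU⟩ := hpath (ℓ - 1) (by omega)
    obtain _ | ⟨y, q⟩ := q
    · simp at hq; omega
    refine absurd hG (not_broomFree_of_isChain hc hn (by simp at hq; omega)
      ((h y (hqU y (by simp))).trans ?_))
    rw [← degIn_univ]
    exact Finset.card_le_card (Finset.filter_subset_filter _ (Finset.subset_univ _))

lemma BroomFree.card_common_lt {V : Type*} [Fintype V] {G : SimpleGraph V} {k s : ℕ}
    (hG : BroomFree (2 * k + 3) s G) {A W : Finset V} (hA : #A = k + 1)
    (hAW : ∀ a ∈ A, ∀ w ∈ W, G.Adj a w) : #W < 2 * k + 3 + s := by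
  by_contra! hW
  obtain ⟨x, hx⟩ : W.Nonempty := Finset.card_pos.1 (by omega)
  refine absurd hG (not_broomFree_of_hubs (x := x) (q := []) hW (Finset.card_pos.1 (by omega))
    hAW (fun a ha => (hAW a ha x hx).symm) (by simp) (by simp) (fun a ha => ?_) (by simp; omega))
  simpa using (hAW a ha x hx).ne

lemma BroomFree.sum_degree_le {V : Type*} [Fintype V] {G : SimpleGraph V} {k s : ℕ}
    (hG : BroomFree (2 * k + 3) s G) (L : Finset V) :
    ∑ v ∈ L, G.degree v ≤ k * Fintype.card V + 2 ^ #L * (2 * k + 3 + s) * #L := by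
  have hB : #{v | k + 1 ≤ degIn G v L} ≤ 2 ^ #L * (2 * k + 3 + s) := by
    calc #{v | k + 1 ≤ degIn G v L}
        ≤ #((L.powersetCard (k + 1)).biUnion fun A => {v | ∀ a ∈ A, G.Adj a v}) := by
          refine Finset.card_le_card fun v hv => ?_
          simp only [Finset.mem_filter, Finset.mem_univ, true_and] at hv
          obtain ⟨A, hAL, hA⟩ := Finset.exists_subset_card_eq hv
          simp only [Finset.mem_biUnion, Finset.mem_powersetCard, Finset.mem_filter,
            Finset.mem_univ, true_and]
          exact ⟨A, ⟨hAL.trans (Finset.filter_subset _ _), hA⟩, fun a ha =>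
            ((Finset.mem_filter.1 (hAL ha)).2).symm⟩
      _ ≤ #(L.powersetCard (k + 1)) * (2 * k + 3 + s) :=
          Finset.card_biUnion_le_card_mul _ _ _ fun A hA =>
            by
            refine (hG.card_common_lt (Finset.mem_powersetCard.1 hA).2 fun a ha w hw => ?_).le
            exact (Finset.mem_filter.1 hw).2 a ha
      _ ≤ 2 ^ #L * (2 * k + 3 + s) := by
          gcongr
          rw [← Finset.card_powerset]
          exact Finset.card_le_card fun A hA =>
            Finset.mem_powerset.2 (Finset.mem_powersetCard.1 hA).1
  simp only [← degIn_univ]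
  rw [sum_degIn_comm]
  calc ∑ v, degIn G v L ≤ ∑ v, (k + if k + 1 ≤ degIn G v L then #L else 0) := by
        refine Finset.sum_le_sum fun v _ => ?_
        split_ifs with h
        · exact (degIn_le_card G v L).trans (by omega)
        · omega
    _ = k * Fintype.card V + #{v | k + 1 ≤ degIn G v L} * #L := by
        rw [Finset.sum_add_distrib, ← Finset.sum_filter]
        simp [mul_comm]
    _ ≤ _ := by gcongr

lemma card_nonadj_le {V : Type*} [Fintype V] (G : SimpleGraph V) {A S : Finset V}
    (hS : ∀ v ∈ S, ∃ a ∈ A, a ≠ v ∧ ¬ G.Adj a v) :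
    #S ≤ ∑ a ∈ A, (Fintype.card V - 1 - G.degree a) := by
  calc #S ≤ #(A.biUnion fun a => Gᶜ.neighborFinset a) := by
        refine Finset.card_le_card fun v hv => ?_
        simpa [SimpleGraph.compl_adj] using hS v hv
    _ ≤ ∑ a ∈ A, #(Gᶜ.neighborFinset a) := Finset.card_biUnion_le
    _ = _ := Finset.sum_congr rfl fun a _ => by
        rw [SimpleGraph.card_neighborFinset_eq_degree, SimpleGraph.degree_compl]

lemma mul_le_or_mul_le_of_mul_le_sq {M d c n : ℕ} (hn : n = d + c)
    (h : 4 * M * (d * c) ≤ n ^ 2) : M * d ≤ n ∨ M * c ≤ n := by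
  by_contra! hcon
  obtain ⟨h₁, h₂⟩ := hcon
  have hn0 : 0 < n := by
    by_contra! h0
    have hd : d = 0 := by omega
    simp [hd] at h₁
  have hsq : 0 < n * n := Nat.mul_pos hn0 hn0
  rcases le_total d c with hdc | hdc
  · have h3 : n * n ≤ (2 * c) * (M * d) := Nat.mul_le_mul (by omega) h₁.le
    linarith
  · have h3 : n * n ≤ (2 * d) * (M * c) := Nat.mul_le_mul (by omega) h₂.le
    linarith

/-- A broom-free graph whose degree square sum is nearly `k n ^ 2` has exactly `k` vertices
of nearly full degree. -/
lemma exists_hubs (k s M : ℕ) (hk : 1 ≤ k) (hM : 16 * (2 * k + 3 + s) ≤ M) :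
    ∃ N, ∀ (n : ℕ), N ≤ n → ∀ G : SimpleGraph (Fin n), BroomFree (2 * k + 3) s G →
      k * (n - 1) ^ 2 ≤ ∑ v, G.degree v ^ 2 →
      ∃ A : Finset (Fin n), #A = k ∧ ∀ a ∈ A, M * (n - 1 - G.degree a) ≤ n := by
  obtain ⟨D, hD⟩ : ∃ D, D = 2 * (2 * k + 3 + s) := ⟨_, rfl⟩
  obtain ⟨P, hP⟩ : ∃ P, P = 8 * D * M := ⟨_, rfl⟩
  obtain ⟨C, hC⟩ : ∃ C, C = 2 ^ (P * D) * (2 * k + 3 + s) * (P * D) := ⟨_, rfl⟩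
  refine ⟨P * (C + 2 * k) + 8 * (2 * k + 3 + s), fun n hn G hG hsq => ?_⟩
  have hn0 : 8 * (2 * k + 3 + s) ≤ n := by
    have := Nat.zero_le (P * (C + 2 * k)); omega
  have hnP : P * (C + 2 * k) ≤ n := by omega
  have hdeg : ∀ v, G.degree v + 1 ≤ n := fun v => by
    have := G.degree_lt_card_verts v
    simp at this; omega
  have hsum : ∑ v, G.degree v ≤ D * n := by
    have := hG.sum_degIn_le (by omega) Finset.univ
    simp only [degIn_univ] at this
    simpa [hD] using this
  have hMD : 8 * D ≤ M := by omega
  have hsmall : ∀ (Q : ℕ) (S : Finset (Fin n)), (∀ v ∈ S, Q * G.degree v ≤ n) →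
      Q * ∑ v ∈ S, G.degree v ^ 2 ≤ D * n ^ 2 := fun Q S hS => by
    calc Q * ∑ v ∈ S, G.degree v ^ 2 = ∑ v ∈ S, (Q * G.degree v) * G.degree v := by
          rw [Finset.mul_sum]; exact Finset.sum_congr rfl fun v _ => by ring
      _ ≤ ∑ v ∈ S, n * G.degree v := Finset.sum_le_sum fun v hv =>
          Nat.mul_le_mul_right _ (hS v hv)
      _ ≤ ∑ v, n * G.degree v := Finset.sum_le_univ_sum_of_nonneg fun _ => Nat.zero_le _
      _ ≤ n * (D * n) := by rw [← Finset.mul_sum]; gcongr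
      _ = _ := by ring
  have hdich : ∀ v, M * G.degree v ≤ n ∨ M * (n - G.degree v) ≤ n := by
    intro v
    by_cases hv : n ≤ P * G.degree v
    swap
    · left
      have : M * G.degree v ≤ P * G.degree v := by
        gcongr
        rw [hP]
        exact Nat.le_mul_of_pos_left _ (by omega)
      omega
    obtain ⟨L, hL⟩ : ∃ L : Finset (Fin n), L = Finset.univ.filter fun v => n ≤ P * G.degree v :=
      ⟨_, rfl⟩
    have hLc : #L ≤ P * D := by
      have h1 : #L * n ≤ P * D * n := by
        calc #L * n = ∑ v ∈ L, n := by simp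
          _ ≤ ∑ v ∈ L, P * G.degree v := Finset.sum_le_sum fun v hv => by simpa [hL] using hv
          _ ≤ ∑ v, P * G.degree v := Finset.sum_le_univ_sum_of_nonneg fun _ => Nat.zero_le _
          _ ≤ P * (D * n) := by rw [← Finset.mul_sum]; gcongr
          _ = _ := by ring
      exact Nat.le_of_mul_le_mul_right h1 (by omega)
    have h1 : ∑ v ∈ L, G.degree v ≤ k * n + C := by
      refine (hG.sum_degree_le L).trans ?_
      rw [Fintype.card_fin, hC]
      gcongr
      norm_num
    have h2 := hsmall P Lᶜ fun v hv => by simp [hL] at hv; exact hv.le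
    have h3 := Finset.sum_add_sum_compl L fun v => G.degree v ^ 2
    have h4 : G.degree v * (n - G.degree v) ≤ ∑ v ∈ L, G.degree v * (n - G.degree v) :=
      Finset.single_le_sum (f := fun v => G.degree v * (n - G.degree v))
        (fun _ _ => Nat.zero_le _) (by simpa [hL] using hv)
    have h5 : ∑ v ∈ L, G.degree v * (n - G.degree v) + ∑ v ∈ L, G.degree v ^ 2 =
        n * ∑ v ∈ L, G.degree v := by
      rw [← Finset.sum_add_distrib, Finset.mul_sum]
      refine Finset.sum_congr rfl fun v _ => ?_
      obtain ⟨c, hc⟩ := Nat.exists_eq_add_of_lt (hdeg v)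
      rw [show n - G.degree v = c + 1 by omega]
      have := congrArg (fun t => t * G.degree v) hc
      linarith
    obtain ⟨m, rfl⟩ : ∃ m, n = m + 1 := ⟨n - 1, by omega⟩
    rw [Nat.add_sub_cancel] at hsq
    rw [← h3] at hsq
    generalize ∑ v ∈ L, G.degree v * (m + 1 - G.degree v) = X at *
    generalize ∑ v ∈ L, G.degree v ^ 2 = Y at *
    generalize ∑ v ∈ Lᶜ, G.degree v ^ 2 = Z at *
    generalize ∑ v ∈ L, G.degree v = S at *
    have h6 : X ≤ (C + 2 * k) * (m + 1) + Z := by nlinarith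
    have h7 : P * X ≤ 2 * D * (m + 1) ^ 2 := by
      have h8 : P * X ≤ P * ((C + 2 * k) * (m + 1) + Z) := Nat.mul_le_mul_left _ h6
      have h9 : P * (C + 2 * k) * (m + 1) ≤ (m + 1) * (m + 1) := Nat.mul_le_mul_right _ hnP
      have : 1 ≤ D := by omega
      nlinarith
    have h8 : 4 * M * X ≤ (m + 1) ^ 2 := by
      rw [hP] at h7
      refine _root_.le_of_mul_le_mul_left (a := 2 * D) ?_ (by omega)
      linarith
    have h9 : 4 * M * (G.degree v * (m + 1 - G.degree v)) ≤ (m + 1) ^ 2 :=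
      (Nat.mul_le_mul_left _ h4).trans h8
    exact mul_le_or_mul_le_of_mul_le_sq (by have := hdeg v; omega) h9
  obtain ⟨A, hA⟩ : ∃ A : Finset (Fin n), A = Finset.univ.filter fun v => M * (n - G.degree v) ≤ n :=
    ⟨_, rfl⟩
  have hAM : ∀ a ∈ A, M * (n - 1 - G.degree a) ≤ n := fun a ha => by
    have : M * (n - G.degree a) ≤ n := by simpa [hA] using ha
    exact (Nat.mul_le_mul_left _ (by omega)).trans this
  refine ⟨A, le_antisymm ?_ ?_, hAM⟩
  · by_contra! hlt
    obtain ⟨B, hBA, hB⟩ := Finset.exists_subset_card_eq (show k + 1 ≤ #A from hlt)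
    obtain ⟨W, hW⟩ : ∃ W : Finset (Fin n), W = Finset.univ.filter fun v => ∀ a ∈ B, G.Adj a v :=
      ⟨_, rfl⟩
    have h1 : #W < 2 * k + 3 + s := hG.card_common_lt hB fun a ha w hw => by
      rw [hW, Finset.mem_filter] at hw
      exact hw.2 a ha
    have h2 := card_nonadj_le G (A := B) (S := (W ∪ B)ᶜ) fun v hv => by
      simp only [hW, Finset.mem_compl, Finset.mem_union, Finset.mem_filter, Finset.mem_univ,
        true_and, not_or, not_forall] at hv
      obtain ⟨⟨a, ha, hav⟩, hvB⟩ := hv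
      exact ⟨a, ha, fun h => hvB (h ▸ ha), hav⟩
    rw [Fintype.card_fin] at h2
    have h3 : M * ∑ a ∈ B, (n - 1 - G.degree a) ≤ (k + 1) * n := by
      rw [Finset.mul_sum, ← hB, ← smul_eq_mul]
      exact Finset.sum_le_card_nsmul _ _ _ fun a ha => hAM a (hBA ha)
    have h4 := Finset.card_add_card_compl (W ∪ B)
    have h5 := Finset.card_union_le W B
    rw [Fintype.card_fin] at h4
    generalize ∑ a ∈ B, (n - 1 - G.degree a) = T at *
    have h6 : 4 * T ≤ n := by
      by_contra! h
      have : 4 * (k + 1) * T ≤ M * T := Nat.mul_le_mul_right _ (by omega)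
      nlinarith
    omega
  · by_contra! hlt
    have h1 := hsmall M Aᶜ fun v hv => by
      rcases hdich v with h | h
      · exact h
      · simp [hA] at hv; omega
    have h2 := Finset.sum_add_sum_compl A fun v => G.degree v ^ 2
    have h3 : ∑ v ∈ A, G.degree v ^ 2 ≤ #A * (n - 1) ^ 2 := by
      rw [← smul_eq_mul]
      refine Finset.sum_le_card_nsmul _ _ _ fun a _ => Nat.pow_le_pow_left ?_ _
      have := hdeg a
      omega
    obtain ⟨m, rfl⟩ : ∃ m, n = m + 1 := ⟨n - 1, by omega⟩
    rw [Nat.add_sub_cancel] at hsq h3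
    rw [← h2] at hsq
    have h4 : (#A + 1) * m ^ 2 ≤ k * m ^ 2 := Nat.mul_le_mul_right _ hlt
    have h5 : m ^ 2 ≤ ∑ v ∈ Aᶜ, G.degree v ^ 2 := by linarith
    have h6 : M * m ^ 2 ≤ D * (m + 1) ^ 2 := (Nat.mul_le_mul_left _ h5).trans h1
    have h7 : (m + 1) ^ 2 ≤ (2 * m) ^ 2 := Nat.pow_le_pow_left (by omega) _
    have h8 : 8 * D * m ^ 2 ≤ M * m ^ 2 := Nat.mul_le_mul_right _ hMD
    have h9 : 0 < D * m ^ 2 := Nat.mul_pos (by omega) (pow_pos (by omega) _)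
    have h10 : D * (m + 1) ^ 2 ≤ D * (2 * m) ^ 2 := Nat.mul_le_mul_left _ h7
    linarith

lemma BroomFree.degIn_common_le_one {V : Type*} [Fintype V] {G : SimpleGraph V} {k s : ℕ}
    (hG : BroomFree (2 * k + 3) s G) {A W : Finset V} (hA : #A = k) (hk : 1 ≤ k)
    (hAW : ∀ a ∈ A, ∀ w ∈ W, G.Adj a w) (hW : 2 * k + 3 + s ≤ #W) {v : V} (hv : v ∉ A) :
    degIn G v W ≤ 1 := by
  by_contra! h
  obtain ⟨w₁, h₁, w₂, h₂, hne⟩ := Finset.one_lt_card.1 h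
  simp only [Finset.mem_filter] at h₁ h₂
  refine absurd hG (not_broomFree_of_hubs (x := w₂) (q := [v, w₁]) hW
    (Finset.card_pos.1 (by omega)) hAW (fun a ha => (hAW a ha _ h₂.1).symm) ?_ ?_
    (fun a ha => ?_) (by simp; omega))
  · simp [h₁.2, h₂.2.symm]
  · simp [h₁.2.ne, h₂.2.ne.symm, hne.symm]
  · simp [(hAW a ha _ h₂.1).ne, (hAW a ha _ h₁.1).ne, ne_of_mem_of_not_mem ha hv]

lemma BroomFree.sum_degIn_common_le_two {V : Type*} [Fintype V] {G : SimpleGraph V} {k s : ℕ}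
    (hG : BroomFree (2 * k + 3) s G) {A W : Finset V} (hA : #A = k) (hk : 2 ≤ k)
    (hAW : ∀ a ∈ A, ∀ w ∈ W, G.Adj a w) (hW : 2 * k + 3 + s ≤ #W) :
    ∑ w ∈ W, degIn G w W ≤ 2 := by
  have hWA : ∀ w ∈ W, w ∉ A := fun w hw hwA => (hAW w hwA w hw).ne rfl
  have hone : ∀ w ∈ W, degIn G w W ≤ 1 := fun w hw =>
    hG.degIn_common_le_one hA (by omega) hAW hW (hWA w hw)
  by_contra! h
  have hE : 2 < #{w ∈ W | degIn G w W ≠ 0} := by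
    refine h.trans_le ?_
    rw [Finset.card_filter]
    refine Finset.sum_le_sum fun w hw => ?_
    have := hone w hw
    split_ifs <;> omega
  have hnbr : ∀ w, degIn G w W ≠ 0 → ∃ u ∈ W, G.Adj w u := fun w hw => by
    obtain ⟨u, hu⟩ := Finset.card_pos.1 (Nat.pos_of_ne_zero hw)
    exact ⟨u, Finset.mem_filter.1 hu⟩
  have huniq : ∀ w ∈ W, ∀ u ∈ W, ∀ v ∈ W, G.Adj w u → G.Adj w v → u = v :=
    fun w hw u hu v hv hwu hwv => Finset.card_le_one.1 (hone w hw) u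
      (Finset.mem_filter.2 ⟨hu, hwu⟩) v (Finset.mem_filter.2 ⟨hv, hwv⟩)
  obtain ⟨a, ha⟩ := Finset.card_pos.1 (by omega : 0 < #{w ∈ W | degIn G w W ≠ 0})
  rw [Finset.mem_filter] at ha
  obtain ⟨b, hb, hab⟩ := hnbr a ha.2
  obtain ⟨c, hc, hcab⟩ : ∃ c ∈ ({w ∈ W | degIn G w W ≠ 0} : Finset V), c ∉ ({a, b} : Finset V) :=
    Finset.exists_mem_notMem_of_card_lt_card (Finset.card_le_two.trans_lt hE)
  rw [Finset.mem_filter] at hc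
  simp only [Finset.mem_insert, Finset.mem_singleton, not_or] at hcab
  obtain ⟨d, hd, hcd⟩ := hnbr c hc.2
  have hda : d ≠ a := by
    rintro rfl
    exact hcab.2 (huniq d hd c hc.1 b hb hcd.symm hab)
  have hdb : d ≠ b := by
    rintro rfl
    exact hcab.1 (huniq d hd c hc.1 a ha.1 hcd.symm hab.symm)
  obtain ⟨x, hx⟩ := Finset.card_pos.1 (by omega : 0 < #A)
  have hAe := Finset.card_erase_add_one hx
  have hxW : ∀ w ∈ W, x ≠ w := fun w hw => (hAW x hx w hw).ne
  refine absurd hG (not_broomFree_of_hubs (A := A.erase x) (x := d) (q := [c, x, b, a]) hW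
    (Finset.card_pos.1 (by omega)) (fun y hy => hAW y (Finset.mem_of_mem_erase hy))
    (fun y hy => (hAW y (Finset.mem_of_mem_erase hy) _ hd).symm) ?_ ?_
    (fun y hy => ?_) (by simp; omega))
  · simp [hcd.symm, hab.symm, hAW x hx b hb, (hAW x hx c hc.1).symm]
  · simp [hcd.ne.symm, hda, hdb, hcab, hab.ne.symm, hxW _ hb, hxW _ ha.1, (hxW _ hc.1).symm,
      (hxW _ hd).symm]
  · have hyW : ∀ w ∈ W, y ≠ w := fun w hw => (hAW y (Finset.mem_of_mem_erase hy) w hw).ne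
    simp [hyW d hd, hyW c hc.1, hyW b hb, hyW a ha.1, Finset.ne_of_mem_erase hy]

lemma pow_degree_common_le {k b a u r : ℕ} (hb : b ≤ 1) (ha : a ≤ u) :
    (k + b + a) ^ (r + 1) ≤ k ^ (r + 1) + b * ((k + 1) ^ (r + 1) - k ^ (r + 1)) +
      a * ((k + 2) * (k + 1 + u) ^ r) := by
  rcases Nat.eq_zero_or_pos a with rfl | ha0
  · have : k ^ (r + 1) ≤ (k + 1) ^ (r + 1) := Nat.pow_le_pow_left (by omega) _
    interval_cases b
    · simp
    · simp; omega
  · calc (k + b + a) ^ (r + 1) = (k + b + a) * (k + b + a) ^ r := by ring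
      _ ≤ (a * (k + 2)) * (k + 1 + u) ^ r := by
        gcongr
        · nlinarith
      _ = a * ((k + 2) * (k + 1 + u) ^ r) := by ring
      _ ≤ _ := Nat.le_add_left _ _

/-- Once `k` vertices of nearly full degree are fixed, the degree power sum is at most the extremal
value, and equality forces them to have full degree and a single edge to lie in their common
neighbourhood. -/
lemma BroomFree.sum_pow_degree_le {k s r M n : ℕ} (hk : 2 ≤ k) (hr : 1 ≤ r)
    (hM : 2 * k * (2 * k + 3 + 2 * (2 * k + 3 + s)) ≤ M)
    (hn : 2 * ((2 * k + 3 + 2 * (2 * k + 3 + s)) * (k + 1) + 2) ≤ n)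
    {G : SimpleGraph (Fin n)} (hG : BroomFree (2 * k + 3) s G) {A : Finset (Fin n)} (hA : #A = k)
    (hAM : ∀ a ∈ A, M * (n - 1 - G.degree a) ≤ n) :
    ∑ v, G.degree v ^ (r + 1) ≤
      k * (n - 1) ^ (r + 1) + 2 * (k + 1) ^ (r + 1) + (n - k - 2) * k ^ (r + 1) ∧
    (∑ v, G.degree v ^ (r + 1) =
      k * (n - 1) ^ (r + 1) + 2 * (k + 1) ^ (r + 1) + (n - k - 2) * k ^ (r + 1) →
      (∀ a ∈ A, ∀ v, a ≠ v → G.Adj a v) ∧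
      ∑ w ∈ Aᶜ, degIn G w Aᶜ = 2) := by
  obtain ⟨D, hD⟩ : ∃ D, D = 2 * (2 * k + 3 + s) := ⟨_, rfl⟩
  obtain ⟨Q, hQ⟩ : ∃ Q, Q = 2 * k + 3 + D := ⟨_, rfl⟩
  rw [← hD, ← hQ] at hM hn
  obtain ⟨m, hm⟩ : ∃ m, m = ∑ a ∈ A, (n - 1 - G.degree a) := ⟨_, rfl⟩
  obtain ⟨W, hWdef⟩ : ∃ W : Finset (Fin n), W = Finset.univ.filter fun v => ∀ a ∈ A, G.Adj a v :=
    ⟨_, rfl⟩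
  obtain ⟨U, hUdef⟩ : ∃ U : Finset (Fin n), U = Aᶜ \ W := ⟨_, rfl⟩
  have hAW : ∀ a ∈ A, ∀ w ∈ W, G.Adj a w := fun a ha w hw => by
    rw [hWdef, Finset.mem_filter] at hw
    exact hw.2 a ha
  have hWA : W ⊆ Aᶜ := fun w hw => Finset.mem_compl.2 fun hwA => (hAW w hwA w hw).ne rfl
  have hUW : W ∪ U = Aᶜ := by rw [hUdef]; exact Finset.union_sdiff_of_subset hWA
  have hdWU : Disjoint W U := hUdef ▸ Finset.disjoint_sdiff
  have hdA : Disjoint A (W ∪ U) := hUW ▸ disjoint_compl_right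
  have hAUW : A ∪ (W ∪ U) = Finset.univ := hUW ▸ Finset.union_compl A
  have hbad : ∀ v ∈ U, ∃ a ∈ A, a ≠ v ∧ ¬ G.Adj a v := fun v hv => by
    simp only [hUdef, hWdef, Finset.mem_sdiff, Finset.mem_compl, Finset.mem_filter,
      Finset.mem_univ, true_and, not_forall] at hv ⊢
    obtain ⟨hvA, a, ha, hav⟩ := hv
    exact ⟨a, ha, fun h => hvA (h ▸ ha), hav⟩
  have hUm : #U ≤ m := by
    have := card_nonadj_le G hbad
    rwa [Fintype.card_fin, ← hm] at this
  have hmn : 2 * Q * m ≤ n := by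
    have h1 : M * m ≤ k * n := by
      rw [hm, Finset.mul_sum, ← hA, ← smul_eq_mul]
      exact Finset.sum_le_card_nsmul _ _ _ hAM
    have h2 := Nat.mul_le_mul_right m hM
    refine _root_.le_of_mul_le_mul_left (a := k) ?_ (by omega)
    nlinarith
  have hQU : 2 * Q * #U ≤ n := (Nat.mul_le_mul_left _ hUm).trans hmn
  have hcard : k + #W + #U = n := by
    have := congrArg Finset.card hAUW
    rw [Finset.card_union_of_disjoint hdA, Finset.card_union_of_disjoint hdWU, hA,
      Finset.card_univ, Fintype.card_fin] at this
    omega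
  have hWc : 2 * k + 3 + s ≤ #W := by
    have h1 : 4 * #U ≤ 2 * Q * #U := Nat.mul_le_mul_right _ (by omega)
    have h2 : Q * 1 ≤ Q * (k + 1) := Nat.mul_le_mul_left _ (by omega)
    omega
  have hdeg : ∀ v, G.degree v = degIn G v A + (degIn G v W + degIn G v U) := fun v => by
    rw [← degIn_union G v hdWU, ← degIn_union G v hdA, hAUW, degIn_univ]
  have hdA1 : ∀ v, degIn G v A ≤ k := fun v => hA ▸ degIn_le_card G v A
  have hdW1 : ∀ v ∉ A, degIn G v W ≤ 1 := fun v =>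
    hG.degIn_common_le_one hA (by omega) hAW hWc
  have hAW2 : ∀ w ∈ W, degIn G w A = k := fun w hw => by
    rw [← hA, degIn, Finset.filter_true_of_mem fun a ha => (hAW a ha w hw).symm]
  have hB := hG.sum_degIn_common_le_two hA hk hAW hWc
  have hsA : ∑ v ∈ A, G.degree v ^ (r + 1) + m * (n - 1) ^ r ≤ k * (n - 1) ^ (r + 1) := by
    rw [hm, Finset.sum_mul, ← Finset.sum_add_distrib, ← hA, ← smul_eq_mul]
    refine Finset.sum_le_card_nsmul _ _ _ fun a _ => ?_
    have hd : G.degree a ≤ n - 1 := by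
      have := G.degree_lt_card_verts a
      rw [Fintype.card_fin] at this
      omega
    calc G.degree a ^ (r + 1) + (n - 1 - G.degree a) * (n - 1) ^ r
        = G.degree a * G.degree a ^ r + (n - 1 - G.degree a) * (n - 1) ^ r := by ring
      _ ≤ G.degree a * (n - 1) ^ r + (n - 1 - G.degree a) * (n - 1) ^ r := by gcongr
      _ = (n - 1) ^ (r + 1) := by rw [← add_mul, Nat.add_sub_cancel' hd]; ring
  have hsU : ∑ v ∈ U, G.degree v ^ (r + 1) ≤ (k + 1 + D) * #U * (k + 1 + #U) ^ r := by
    have hUA : ∀ v ∈ U, v ∉ A := fun v hv =>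
      Finset.mem_compl.1 (Finset.mem_sdiff.1 (hUdef ▸ hv)).1
    calc ∑ v ∈ U, G.degree v ^ (r + 1)
        ≤ ∑ v ∈ U, (k + 1 + degIn G v U) * (k + 1 + #U) ^ r := by
          refine Finset.sum_le_sum fun v hv => ?_
          have h1 := hdeg v
          have h2 := hdA1 v
          have h3 := hdW1 v (hUA v hv)
          have h4 := degIn_le_card G v U
          rw [pow_succ']
          gcongr <;> omega
      _ = ((k + 1) * #U + ∑ v ∈ U, degIn G v U) * (k + 1 + #U) ^ r := by
          rw [← Finset.sum_mul, Finset.sum_add_distrib, Finset.sum_const, smul_eq_mul,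
            mul_comm #U]
      _ ≤ ((k + 1) * #U + D * #U) * (k + 1 + #U) ^ r := by
          gcongr
          rw [hD]
          exact hG.sum_degIn_le (by omega) U
      _ = _ := by ring
  have hsW : ∑ v ∈ W, G.degree v ^ (r + 1) ≤ #W * k ^ (r + 1) +
      (∑ w ∈ W, degIn G w W) * ((k + 1) ^ (r + 1) - k ^ (r + 1)) +
      #U * ((k + 2) * (k + 1 + #U) ^ r) := by
    have hWU : ∑ w ∈ W, degIn G w U ≤ #U := by
      rw [sum_degIn_comm, ← mul_one #U, ← smul_eq_mul]
      exact Finset.sum_le_card_nsmul _ _ _ fun v hv =>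
        hdW1 v (Finset.mem_compl.1 (Finset.mem_sdiff.1 (hUdef ▸ hv)).1)
    calc ∑ v ∈ W, G.degree v ^ (r + 1)
        ≤ ∑ w ∈ W, (k ^ (r + 1) + degIn G w W * ((k + 1) ^ (r + 1) - k ^ (r + 1)) +
            degIn G w U * ((k + 2) * (k + 1 + #U) ^ r)) := by
          refine Finset.sum_le_sum fun w hw => ?_
          rw [hdeg w, hAW2 w hw, ← add_assoc]
          exact pow_degree_common_le (hdW1 w (Finset.mem_compl.1 (hWA hw))) (degIn_le_card G w U)
      _ = #W * k ^ (r + 1) + (∑ w ∈ W, degIn G w W) * ((k + 1) ^ (r + 1) - k ^ (r + 1)) +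
          (∑ w ∈ W, degIn G w U) * ((k + 2) * (k + 1 + #U) ^ r) := by
          rw [Finset.sum_add_distrib, Finset.sum_add_distrib, Finset.sum_mul, Finset.sum_mul,
            Finset.sum_const, smul_eq_mul]
      _ ≤ _ := by gcongr
  have hX : Q * (k + 1 + #U) ^ r < (n - 1) ^ r := by
    calc Q * (k + 1 + #U) ^ r ≤ Q ^ r * (k + 1 + #U) ^ r := by
          gcongr
          exact Nat.le_self_pow (by omega) Q
      _ = (Q * (k + 1 + #U)) ^ r := (mul_pow _ _ _).symm
      _ < (n - 1) ^ r := by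
          refine Nat.pow_lt_pow_left ?_ (by omega)
          have : Q * (k + 1 + #U) = Q * (k + 1) + Q * #U := by ring
          rw [mul_assoc] at hQU
          omega
  have htotal : ∑ v, G.degree v ^ (r + 1) = ∑ v ∈ A, G.degree v ^ (r + 1) +
      (∑ v ∈ W, G.degree v ^ (r + 1) + ∑ v ∈ U, G.degree v ^ (r + 1)) := by
    rw [← Finset.sum_union hdWU, ← Finset.sum_union hdA, hAUW]
  obtain ⟨δ, hδ⟩ : ∃ δ, (k + 1) ^ (r + 1) = k ^ (r + 1) + δ :=
    Nat.exists_eq_add_of_le (Nat.pow_le_pow_left (by omega) _)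
  have hδ0 : 0 < δ := by
    have : k ^ (r + 1) < (k + 1) ^ (r + 1) := Nat.pow_lt_pow_left (by omega) (by omega)
    omega
  have hW2 : #W * k ^ (r + 1) ≤ (n - k - 2) * k ^ (r + 1) + 2 * k ^ (r + 1) := by
    rw [← add_mul]
    exact Nat.mul_le_mul_right _ (by omega)
  have hQX : (k + 1 + D) * #U * (k + 1 + #U) ^ r + #U * ((k + 2) * (k + 1 + #U) ^ r) ≤
      m * (Q * (k + 1 + #U) ^ r) := by
    calc _ = #U * (Q * (k + 1 + #U) ^ r) := by rw [hQ]; ring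
      _ ≤ _ := Nat.mul_le_mul_right _ hUm
  obtain ⟨c, hc⟩ := Nat.exists_eq_add_of_lt hX
  rw [hc, mul_add, mul_add] at hsA
  rw [hδ, Nat.add_sub_cancel_left] at hsW
  obtain ⟨e, he⟩ := Nat.exists_eq_add_of_le hB
  have hkey : ∑ v, G.degree v ^ (r + 1) + (m + e * δ) ≤
      k * (n - 1) ^ (r + 1) + 2 * (k + 1) ^ (r + 1) + (n - k - 2) * k ^ (r + 1) := by
    have h1 : 2 * δ = (∑ w ∈ W, degIn G w W) * δ + e * δ := by rw [← add_mul, ← he]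
    rw [hδ]
    nlinarith
  refine ⟨(Nat.le_add_right _ _).trans hkey, fun heq => ?_⟩
  have hme : m + e * δ = 0 := by omega
  have hm0 : m = 0 := by omega
  have he0 : e = 0 := by
    rcases Nat.mul_eq_zero.1 (by omega : e * δ = 0) with h | h <;> omega
  have hbad0 : ∀ a ∈ A, ∀ v, a ≠ v → G.Adj a v := by
    intro a ha v hav
    by_contra hadj
    have h1 := card_nonadj_le G (A := A) (S := {v}) fun w hw =>
      ⟨a, ha, Finset.mem_singleton.1 hw ▸ ⟨hav, hadj⟩⟩
    rw [Fintype.card_fin, ← hm, hm0, Finset.card_singleton] at h1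
    omega
  have hU0 : U = ∅ := Finset.card_eq_zero.1 (by omega)
  rw [← hUW, hU0, Finset.union_empty]
  exact ⟨hbad0, by omega⟩

lemma exists_unique_edge_of_sum_degIn {V : Type*} {G : SimpleGraph V} {S : Finset V}
    (h : ∑ w ∈ S, degIn G w S = 2) :
    ∃ x ∈ S, ∃ y ∈ S, G.Adj x y ∧
      ∀ u ∈ S, ∀ v ∈ S, G.Adj u v → (u = x ∧ v = y) ∨ (u = y ∧ v = x) := by
  have hpos : ∀ u ∈ S, ∀ v ∈ S, G.Adj u v → 1 ≤ degIn G u S := fun u _ v hv huv =>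
    Finset.card_pos.2 ⟨v, Finset.mem_filter.2 ⟨hv, huv⟩⟩
  obtain ⟨x, hx, hx0⟩ := Finset.exists_ne_zero_of_sum_ne_zero (h.trans_ne two_ne_zero)
  obtain ⟨y, hy⟩ := Finset.card_pos.1 (Nat.pos_of_ne_zero hx0)
  obtain ⟨hy, hxy⟩ := Finset.mem_filter.1 hy
  have hmem : ∀ u ∈ S, ∀ v ∈ S, G.Adj u v → u = x ∨ u = y := by
    intro u hu v hv huv
    by_contra! hne
    have h1 : ∑ w ∈ {u, x, y}, degIn G w S ≤ ∑ w ∈ S, degIn G w S :=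
      Finset.sum_le_sum_of_subset (by simp [Finset.insert_subset_iff, hu, hx, hy])
    rw [Finset.sum_insert (by simp [hne]), Finset.sum_pair hxy.ne, h] at h1
    have h2 := hpos u hu v hv huv
    have h3 := hpos x hx y hy hxy
    have h4 := hpos y hy x hx hxy.symm
    omega
  refine ⟨x, hx, y, hy, hxy, fun u hu v hv huv => ?_⟩
  rcases hmem u hu v hv huv with rfl | rfl <;> rcases hmem v hv u hu huv.symm with rfl | rfl
  · exact absurd rfl huv.ne
  · exact Or.inl ⟨rfl, rfl⟩
  · exact Or.inr ⟨rfl, rfl⟩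
  · exact absurd rfl huv.ne

lemma sum_pow_degree_of_adj_iff {V : Type*} [Fintype V] {G : SimpleGraph V} {A : Finset V}
    {x y : V} (hx : x ∉ A) (hy : y ∉ A) (hxy : x ≠ y)
    (hG : ∀ u v, G.Adj u v ↔ u ≠ v ∧ (u ∈ A ∨ v ∈ A ∨ (u = x ∧ v = y) ∨ (u = y ∧ v = x)))
    (r : ℕ) :
    ∑ v, G.degree v ^ r = #A * (Fintype.card V - 1) ^ r + 2 * (#A + 1) ^ r +
      (Fintype.card V - #A - 2) * #A ^ r := by
  have hdA : ∀ a ∈ A, G.degree a = Fintype.card V - 1 := fun a ha => by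
    rw [← G.card_neighborFinset_eq_degree, ← Finset.card_univ, ← Finset.card_erase_of_mem
      (Finset.mem_univ a)]
    congr 1
    ext v
    simp [hG, ha, eq_comm]
  have hdx : G.degree x = #A + 1 := by
    rw [← G.card_neighborFinset_eq_degree, ← Finset.card_insert_of_notMem hy]
    congr 1
    ext v
    simp only [SimpleGraph.mem_neighborFinset, hG, Finset.mem_insert]
    grind
  have hdy : G.degree y = #A + 1 := by
    rw [← G.card_neighborFinset_eq_degree, ← Finset.card_insert_of_notMem hx]
    congr 1
    ext v
    simp only [SimpleGraph.mem_neighborFinset, hG, Finset.mem_insert]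
    grind
  have hdo : ∀ v, v ∉ A → v ≠ x → v ≠ y → G.degree v = #A := fun v hv hvx hvy => by
    rw [← G.card_neighborFinset_eq_degree]
    congr 1
    ext u
    simp only [SimpleGraph.mem_neighborFinset, hG]
    grind
  have hdisj : Disjoint A {x, y} := by simp [hx, hy]
  rw [← Finset.sum_add_sum_compl (A ∪ {x, y}), Finset.sum_union hdisj, Finset.sum_pair hxy, hdx,
    hdy, Finset.sum_congr rfl fun a ha => by rw [hdA a ha],
    Finset.sum_congr (s₁ := (A ∪ {x, y})ᶜ) rfl fun v hv => by
      simp only [Finset.mem_compl, Finset.mem_union, Finset.mem_insert, Finset.mem_singleton,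
        not_or] at hv
      rw [hdo v hv.1 hv.2.1 hv.2.2],
    Finset.sum_const, Finset.sum_const, Finset.card_compl, Finset.card_union_of_disjoint hdisj,
    Finset.card_pair hxy, Nat.sub_sub]
  simp only [smul_eq_mul]
  ring

lemma HstarGraph_adj {k n : ℕ} (i j : Fin n) : (HstarGraph k n).Adj i j ↔ i ≠ j ∧
    (i.val < k ∨ j.val < k ∨ (i.val = k ∧ j.val = k + 1) ∨ (i.val = k + 1 ∧ j.val = k)) := by
  rw [HstarGraph, SimpleGraph.fromRel_adj]
  tauto

lemma sum_pow_degree_HstarGraph {k n : ℕ} (hn : k + 2 ≤ n) (r : ℕ) :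
    ∑ v : Fin n, (HstarGraph k n).degree v ^ r =
      k * (n - 1) ^ r + 2 * (k + 1) ^ r + (n - k - 2) * k ^ r := by
  have hcard : #({i | i.val < k} : Finset (Fin n)) = k := by
    rw [Fin.card_filter_val_lt]
    omega
  have := sum_pow_degree_of_adj_iff (G := HstarGraph k n)
    (A := ({i | i.val < k} : Finset (Fin n))) (x := ⟨k, by omega⟩) (y := ⟨k + 1, by omega⟩)
    (by simp) (by simp) (by simp) (fun u v => by simp [HstarGraph_adj, Fin.ext_iff]) r
  rwa [hcard, Fintype.card_fin] at this

lemma nonempty_iso_HstarGraph {k n : ℕ} (hn : k + 2 ≤ n) {G : SimpleGraph (Fin n)}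
    {A : Finset (Fin n)} (hA : #A = k) {x y : Fin n} (hx : x ∉ A) (hy : y ∉ A) (hxy : x ≠ y)
    (hG : ∀ u v, G.Adj u v ↔ u ≠ v ∧ (u ∈ A ∨ v ∈ A ∨ (u = x ∧ v = y) ∨ (u = y ∧ v = x))) :
    Nonempty (G ≃g HstarGraph k n) := by
  let e : Fin k ≃ A := (Finset.equivFinOfCardEq hA).symm
  let f : Fin n → Fin n := fun i =>
    if hi : i.val < k then e ⟨i, hi⟩ else if i.val = k then x else y
  have hfA : ∀ i : Fin n, i.val < k → f i ∈ A := fun i hi => by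
    simp only [f, dif_pos hi]
    exact (e _).2
  have hfx : ∀ i : Fin n, i.val = k → f i = x := fun i hi => by simp [f, hi]
  have hfy : ∀ i : Fin n, i.val = k + 1 → f i = y := fun i hi => by simp [f, hi]
  have hinj : Set.InjOn f ({i | i.val < k + 2} : Finset (Fin n)) := by
    intro i hi j hj hij
    simp only [Finset.mem_coe, Finset.mem_filter, Finset.mem_univ, true_and] at hi hj
    have hcases : ∀ i : Fin n, i.val < k + 2 → i.val < k ∨ i.val = k ∨ i.val = k + 1 :=
      fun i hi => by omega
    rcases hcases i hi with h1 | h1 | h1 <;> rcases hcases j hj with h2 | h2 | h2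
    · simp only [f, dif_pos h1, dif_pos h2] at hij
      have := e.injective (Subtype.ext hij)
      simp only [Fin.mk.injEq] at this
      exact Fin.ext this
    · exact absurd (hfx j h2 ▸ hij ▸ hfA i h1) hx
    · exact absurd (hfy j h2 ▸ hij ▸ hfA i h1) hy
    · exact absurd (hfx i h1 ▸ hij ▸ hfA j h2) hx
    · exact Fin.ext (h1.trans h2.symm)
    · exact absurd (hfx i h1 ▸ hfy j h2 ▸ hij) hxy
    · exact absurd (hfy i h1 ▸ hij ▸ hfA j h2) hy
    · exact absurd (hfy i h1 ▸ hfx j h2 ▸ hij) hxy.symm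
    · exact Fin.ext (h1.trans h2.symm)
  obtain ⟨g, hg⟩ := Finset.exists_equiv_extend_of_card_eq (t := Finset.univ) (by simp)
    (Finset.subset_univ _) hinj
  let σ : Fin n ≃ Fin n := g.trans (Equiv.subtypeUnivEquiv Finset.mem_univ)
  have hσ : ∀ i : Fin n, i.val < k + 2 → σ i = f i := fun i hi => hg i (by simpa using hi)
  have hσA : ∀ i, σ i ∈ A ↔ i.val < k := fun i => by
    refine ⟨fun hi => ?_, fun hi => hσ i (by omega) ▸ hfA i hi⟩
    have hj : (e.symm ⟨σ i, hi⟩).val < n := by omega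
    have h1 : σ ⟨(e.symm ⟨σ i, hi⟩).val, hj⟩ = σ i := by
      rw [hσ _ (by simp only; omega)]
      simp [f]
    rw [← σ.injective h1]
    exact (e.symm ⟨σ i, hi⟩).2
  have hσx : ∀ i, σ i = x ↔ i.val = k := fun i => by
    have h1 : σ ⟨k, by omega⟩ = x := by rw [hσ _ (by simp), hfx _ rfl]
    rw [← h1, σ.apply_eq_iff_eq, Fin.ext_iff]
  have hσy : ∀ i, σ i = y ↔ i.val = k + 1 := fun i => by
    have h1 : σ ⟨k + 1, by omega⟩ = y := by rw [hσ _ (by simp), hfy _ rfl]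
    rw [← h1, σ.apply_eq_iff_eq, Fin.ext_iff]
  refine ⟨SimpleGraph.Iso.symm ⟨σ, fun {i j} => ?_⟩⟩
  rw [hG, HstarGraph_adj, hσA, hσA, hσx, hσy, hσx, hσy, σ.injective.ne_iff]

/-- For odd `ℓ ≥ 7`, `k = (ℓ-3)/2`, `r ≥ 2` and all sufficiently large `n`, every
`n`-vertex `B(ℓ,s)`-free graph `G` satisfies
`e_r(G) ≤ e_r(H*(k,n)) = k(n-1)^r + 2(k+1)^r + (n-k-2)k^r`, with equality iff
`G ≅ H*(k,n)`. -/
theorem er_extremal_broom_odd (ℓ s k r : ℕ) (hℓ : 7 ≤ ℓ) (hodd : Odd ℓ)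
    (hk : k = (ℓ - 3) / 2) (hr : 2 ≤ r) :
    ∃ N : ℕ, ∀ n : ℕ, N ≤ n → ∀ G : SimpleGraph (Fin n), BroomFree ℓ s G →
      (∑ v : Fin n, (HstarGraph k n).degree v ^ r =
          k * (n - 1) ^ r + 2 * (k + 1) ^ r + (n - k - 2) * k ^ r) ∧
      (∑ v : Fin n, G.degree v ^ r ≤ k * (n - 1) ^ r + 2 * (k + 1) ^ r + (n - k - 2) * k ^ r) ∧
      ((∑ v : Fin n, G.degree v ^ r = k * (n - 1) ^ r + 2 * (k + 1) ^ r + (n - k - 2) * k ^ r) ↔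
        Nonempty (G ≃g HstarGraph k n)) := by
  obtain ⟨t, rfl⟩ := hodd
  obtain rfl : t = k + 1 := by omega
  rw [show 2 * (k + 1) + 1 = 2 * k + 3 by ring]
  have hk2 : 2 ≤ k := by omega
  obtain ⟨M, hM⟩ : ∃ M, M = 2 * k * (2 * k + 3 + 2 * (2 * k + 3 + s)) +
    16 * (2 * k + 3 + s) := ⟨_, rfl⟩
  obtain ⟨N, hN⟩ := exists_hubs k s M (by omega) (by omega)
  refine ⟨N + 2 * ((2 * k + 3 + 2 * (2 * k + 3 + s)) * (k + 1) + 2) + (k + 2), fun n hn G hG => ?_⟩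
  obtain ⟨r, rfl⟩ : ∃ p, r = p + 1 := ⟨r - 1, by omega⟩
  have hstar := sum_pow_degree_HstarGraph (k := k) (n := n) (by omega) (r + 1)
  have hlarge : k * (n - 1) ^ (r + 1) ≤ ∑ v, G.degree v ^ (r + 1) →
      ∃ A : Finset (Fin n), #A = k ∧ ∀ a ∈ A, M * (n - 1 - G.degree a) ≤ n := by
    intro h
    refine hN n (by omega) G hG ?_
    have hr1 : r + 1 = (r - 1) + 2 := by omega
    refine le_of_mul_le_mul_left (a := (n - 1) ^ (r - 1)) ?_ (pow_pos (by omega) _)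
    calc (n - 1) ^ (r - 1) * (k * (n - 1) ^ 2) = k * (n - 1) ^ (r + 1) := by
          rw [hr1, pow_add]; ring
      _ ≤ ∑ v, G.degree v ^ (r + 1) := h
      _ ≤ ∑ v, (n - 1) ^ (r - 1) * G.degree v ^ 2 := by
          refine Finset.sum_le_sum fun v _ => ?_
          have hd : G.degree v ≤ n - 1 := by
            have := G.degree_lt_card_verts v
            rw [Fintype.card_fin] at this
            omega
          rw [hr1, pow_add]
          gcongr
      _ = _ := (Finset.mul_sum _ _ _).symm
  have hmain := fun h => hG.sum_pow_degree_le (r := r) hk2 (by omega) (by omega) (by omega)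
    (hlarge h).choose_spec.1 (hlarge h).choose_spec.2
  refine ⟨hstar, ?_, fun heq => ?_, fun ⟨φ⟩ => ?_⟩
  · rcases le_total (k * (n - 1) ^ (r + 1)) (∑ v, G.degree v ^ (r + 1)) with h | h
    · exact (hmain h).1
    · exact h.trans ((Nat.le_add_right _ _).trans (Nat.le_add_right _ _))
  · have h : k * (n - 1) ^ (r + 1) ≤ ∑ v, G.degree v ^ (r + 1) := by omega
    obtain ⟨hfull, hsum⟩ := (hmain h).2 heq
    have hA := (hlarge h).choose_spec.1
    generalize (hlarge h).choose = A at hfull hsum hA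
    obtain ⟨x, hx, y, hy, hxy, huniq⟩ := exists_unique_edge_of_sum_degIn hsum
    refine nonempty_iso_HstarGraph (by omega) hA (Finset.mem_compl.1 hx) (Finset.mem_compl.1 hy)
      hxy.ne fun u v => ⟨fun huv => ⟨huv.ne, ?_⟩, ?_⟩
    · by_cases hu : u ∈ A
      · exact Or.inl hu
      · by_cases hv : v ∈ A
        · exact Or.inr (Or.inl hv)
        · exact Or.inr (Or.inr (huniq u (Finset.mem_compl.2 hu) v (Finset.mem_compl.2 hv) huv))
    · rintro ⟨hne, hu | hv | ⟨rfl, rfl⟩ | ⟨rfl, rfl⟩⟩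
      · exact hfull u hu v hne
      · exact (hfull v hv u hne.symm).symm
      · exact hxy
      · exact hxy.symm
  · rw [← hstar, ← Equiv.sum_comp φ.toEquiv fun v => (HstarGraph k n).degree v ^ (r + 1)]
    exact Finset.sum_congr rfl fun v _ => congrArg (· ^ (r + 1)) (φ.degree_eq v).symm
end

section
/- Let r ≥ 2 and s ≥ 1. For all sufficiently large n, every n-vertex B(5,s)-free graph G satisfies e_r(G) ≤ e_r(F_n) = (n−1)^r + 2⌊(n−1)/2⌋·2^r + (n−1−2⌊(n−1)/2⌋), with equality if and only if G is isomorphic to F_n. -/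
open scoped Classical
open Finset SimpleGraph

/-- `F_n`: the star on `n` vertices with center `0`, together with the matching
`{1,2}, {3,4}, …` of size `⌊(n-1)/2⌋` among the leaves. -/
noncomputable def Fgraph (n : ℕ) : SimpleGraph (Fin n) :=
  SimpleGraph.fromRel (fun a b => a.val = 0 ∨ (a.val % 2 = 1 ∧ b.val = a.val + 1))

/-- `G` consists of all edges at the centre `v` together with the matching formed by the
2-cycles of the involution `σ`, which fixes `v`. -/
structure IsStarWithMatching {V : Type*} (G : SimpleGraph V) (v : V) (σ : Equiv.Perm V) :
    Prop where
  sq_eq_one : σ ^ 2 = 1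
  center : σ v = v
  adj_iff : ∀ a b, G.Adj a b ↔ a ≠ b ∧ (a = v ∨ b = v ∨ σ a = b)

namespace IsStarWithMatching

variable {V : Type*} [Fintype V] [DecidableEq V] {G : SimpleGraph V} {v : V} {σ : Equiv.Perm V}

theorem degree_center (h : IsStarWithMatching G v σ) : G.degree v = Fintype.card V - 1 := by
  have : G.neighborFinset v = univ.erase v := by
    ext a
    simp [h.adj_iff, eq_comm]
  rw [← card_neighborFinset_eq_degree, this, card_erase_of_mem (mem_univ _), card_univ]

theorem degree_of_mem_support (h : IsStarWithMatching G v σ) {a : V} (ha : a ∈ σ.support) :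
    G.degree a = 2 := by
  rw [Equiv.Perm.mem_support] at ha
  have hav : a ≠ v := fun e => ha (by rw [e, h.center])
  have hσv : v ≠ σ a := fun e => hav (σ.injective (by rw [← e, h.center]))
  have : G.neighborFinset a = {v, σ a} := by
    ext b
    simp only [mem_neighborFinset, h.adj_iff, mem_insert, mem_singleton]
    grind
  rw [← card_neighborFinset_eq_degree, this, card_pair hσv]

theorem degree_of_notMem_support (h : IsStarWithMatching G v σ) {a : V} (ha : a ∉ σ.support)
    (hav : a ≠ v) : G.degree a = 1 := by
  rw [Equiv.Perm.notMem_support] at ha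
  have : G.neighborFinset a = {v} := by
    ext b
    simp only [mem_neighborFinset, h.adj_iff, mem_singleton]
    grind
  rw [← card_neighborFinset_eq_degree, this, card_singleton]

theorem support_subset (h : IsStarWithMatching G v σ) : σ.support ⊆ univ.erase v := fun a ha =>
  mem_erase.2 ⟨fun e => Equiv.Perm.mem_support.1 ha (by rw [e, h.center]), mem_univ _⟩

theorem card_support_le (h : IsStarWithMatching G v σ) : #σ.support ≤ Fintype.card V - 1 := by
  simpa [card_erase_of_mem] using card_le_card h.support_subset

theorem sum_degree_pow (h : IsStarWithMatching G v σ) (r : ℕ) :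
    ∑ a, G.degree a ^ r =
      (Fintype.card V - 1) ^ r + #σ.support * 2 ^ r + (Fintype.card V - 1 - #σ.support) := by
  rw [← add_sum_erase _ _ (mem_univ v), ← sum_sdiff h.support_subset, h.degree_center,
    sum_congr rfl (g := fun _ => 2 ^ r) (s₁ := σ.support)
      fun a ha => by rw [h.degree_of_mem_support ha],
    sum_congr rfl (g := fun _ => 1) (s₁ := _ \ σ.support) fun a ha => by
      rw [mem_sdiff, mem_erase] at ha
      rw [h.degree_of_notMem_support ha.2 ha.1.1, one_pow]]
  rw [sum_const, sum_const, card_sdiff_of_subset h.support_subset,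
    card_erase_of_mem (mem_univ v), card_univ]
  simp only [smul_eq_mul, mul_one]
  ring

theorem nonempty_iso {W : Type*} [Fintype W] [DecidableEq W] {H : SimpleGraph W} {w : W}
    {τ : Equiv.Perm W} (h : IsStarWithMatching G v σ) (h' : IsStarWithMatching H w τ)
    (e : V ≃ W) (hc : #σ.support = #τ.support) : Nonempty (G ≃g H) := by
  have hconj : IsConj (e.permCongr σ) τ := by
    have hs : (e.permCongr σ) ^ 2 = 1 := by
      rw [← map_one e.permCongrHom, ← h.sq_eq_one, map_pow]; rfl
    have hcard : #(e.permCongr σ).support = #σ.support := by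
      refine card_bij (fun a _ => e.symm a) ?_ ?_ ?_
      · intro a ha
        simp only [Equiv.Perm.mem_support, Equiv.permCongr_apply] at ha ⊢
        exact fun hh => ha (by rw [hh, e.apply_symm_apply])
      · intro a _ b _ hab
        exact e.symm.injective hab
      · intro b hb
        refine ⟨e b, ?_, e.symm_apply_apply b⟩
        simpa [Equiv.Perm.mem_support] using hb
    have h1 := Equiv.Perm.cycleType_of_pow_prime_eq_one (p := 2) hs
    have h2 := Equiv.Perm.cycleType_of_pow_prime_eq_one (p := 2) h'.sq_eq_one
    have h3 := Equiv.Perm.sum_cycleType (e.permCongr σ)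
    have h4 := Equiv.Perm.sum_cycleType τ
    rw [h1, Multiset.sum_replicate] at h3
    rw [h2, Multiset.sum_replicate] at h4
    rw [Equiv.Perm.isConj_iff_cycleType_eq, h1, h2]
    congr 1
    simp only [smul_eq_mul] at h3 h4
    omega
  obtain ⟨c, hc⟩ := isConj_iff.1 hconj
  have hc' : ∀ a, c (e (σ a)) = τ (c (e a)) := by
    intro a
    have := congrArg (fun f => f (c (e a))) hc
    simpa using this
  have hfix : τ (c (e v)) = c (e v) := by rw [← hc', h.center]
  let g : V ≃ W := (e.trans c).trans (Equiv.swap (c (e v)) w)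
  have hgv : g v = w := by simp [g]
  have hg : ∀ a, g (σ a) = τ (g a) := by
    intro a
    simp only [g, Equiv.trans_apply, hc']
    have h1 := h'.center
    generalize c (e v) = x at *
    generalize c (e a) = y
    by_cases hyx : y = x
    · subst hyx; rw [hfix, Equiv.swap_apply_left, h1]
    by_cases hyw : y = w
    · subst hyw; rw [h1, Equiv.swap_apply_right, hfix]
    rw [Equiv.swap_apply_of_ne_of_ne hyx hyw, Equiv.swap_apply_of_ne_of_ne]
    · exact fun hh => hyx (τ.injective (hh.trans hfix.symm))
    · exact fun hh => hyw (τ.injective (hh.trans h1.symm))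
  refine ⟨⟨g, ?_⟩⟩
  intro a b
  rw [h.adj_iff, h'.adj_iff, ← hg, ← hgv]
  simp

end IsStarWithMatching

/-- The involution exchanging `2i+1` and `2i+2` whenever both are below `n`. -/
def pairSwap (n : ℕ) (a : Fin n) : Fin n :=
  if h : a.val % 2 = 1 ∧ a.val + 1 < n then ⟨a.val + 1, h.2⟩
  else if a.val % 2 = 0 ∧ a.val ≠ 0 then ⟨a.val - 1, by omega⟩ else a

theorem val_pairSwap (n : ℕ) (a : Fin n) : (pairSwap n a).val =
    if a.val % 2 = 1 ∧ a.val + 1 < n then a.val + 1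
    else if a.val % 2 = 0 ∧ a.val ≠ 0 then a.val - 1 else a.val := by
  unfold pairSwap
  split_ifs <;> rfl

theorem pairSwap_involutive (n : ℕ) : Function.Involutive (pairSwap n) := by
  intro a
  apply Fin.ext
  have := a.2
  rw [val_pairSwap, val_pairSwap]
  split_ifs <;> omega

theorem isStarWithMatching_Fgraph {n : ℕ} (hn : 0 < n) :
    IsStarWithMatching (Fgraph n) ⟨0, hn⟩ (pairSwap_involutive n).toPerm where
  sq_eq_one := by
    ext a
    simp [pow_two, pairSwap_involutive n a]
  center := by
    simp [pairSwap]
  adj_iff a b := by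
    have := a.2
    have := b.2
    simp only [Fgraph, SimpleGraph.fromRel_adj, Function.Involutive.coe_toPerm, ne_eq,
      Fin.ext_iff, val_pairSwap]
    split_ifs <;> omega

theorem card_support_pairSwap {n : ℕ} (hn : 0 < n) :
    #(pairSwap_involutive n).toPerm.support = 2 * ((n - 1) / 2) := by
  have h := isStarWithMatching_Fgraph hn
  have h1 := Equiv.Perm.two_dvd_card_support h.sq_eq_one
  have h2 := h.card_support_le
  have h3 : ((pairSwap_involutive n).toPerm.support)ᶜ ⊆
      {⟨0, hn⟩, ⟨n - 1, by omega⟩} := by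
    intro a ha
    have := a.2
    simp only [mem_compl, Equiv.Perm.mem_support, Function.Involutive.coe_toPerm,
      not_not, Fin.ext_iff, val_pairSwap] at ha
    simp only [mem_insert, mem_singleton, Fin.ext_iff]
    split_ifs at ha <;> omega
  have h4 := (card_le_card h3).trans card_le_two
  rw [card_compl] at h4
  simp only [Fintype.card_fin] at *
  omega

theorem sum_degree_pow_Fgraph {n : ℕ} (hn : 0 < n) (r : ℕ) :
    ∑ v : Fin n, (Fgraph n).degree v ^ r =
      (n - 1) ^ r + 2 * ((n - 1) / 2) * 2 ^ r + (n - 1 - 2 * ((n - 1) / 2)) := by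
  rw [(isStarWithMatching_Fgraph hn).sum_degree_pow, card_support_pairSwap hn, Fintype.card_fin]

/-- A vertex of degree at least `s + 4` in a broom-free graph is not the end of a path with
three edges. -/
theorem BroomFree.eq_or_eq {V : Type*} [Fintype V] {G : SimpleGraph V} {s : ℕ}
    (hG : BroomFree 5 s G) {v c b a : V} (hv : s + 4 ≤ G.degree v) (hvc : G.Adj v c)
    (hcb : G.Adj c b) (hba : G.Adj b a) : b = v ∨ a = v ∨ a = c := by
  by_contra! hne
  apply hG
  have hcard : s + 1 ≤ #(G.neighborFinset v \ {c, b, a}) := by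
    have h1 := le_card_sdiff {c, b, a} (G.neighborFinset v)
    have h2 : #({c, b, a} : Finset V) ≤ 3 := card_le_three
    rw [card_neighborFinset_eq_degree] at h1
    omega
  obtain ⟨t, ht, htc⟩ := exists_subset_card_eq hcard
  let g : Fin (s + 1) ≃ t := (t.equivFinOfCardEq htc).symm
  have hg : ∀ i, G.Adj v (g i) ∧ (g i : V) ≠ c ∧ (g i : V) ≠ b ∧ (g i : V) ≠ a := by
    intro i
    have := ht (g i).2
    simpa using this
  have hgi : ∀ i j, (g i : V) = g j → i = j := fun i j h => g.injective (Subtype.ext h)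
  let f : Fin (5 + s) → V := fun i =>
    if i.val = 0 then a else if i.val = 1 then b else if i.val = 2 then c
    else if i.val = 3 then v else g ⟨i.val - 4, by omega⟩
  have hba' := hba.ne
  have hcb' := hcb.ne
  have hvc' := hvc.ne
  have hinj : ∀ i j : Fin (5 + s), i.val < j.val → f i ≠ f j := by
    intro i j hij hf
    have hj : ∀ h, v ≠ (g ⟨j.val - 4, h⟩ : V) := fun h => (hg _).1.ne
    have hji : ∀ h h', (g ⟨i.val - 4, h'⟩ : V) = (g ⟨j.val - 4, h⟩ : V) →
        i.val - 4 = j.val - 4 := fun h h' e => by simpa using hgi _ _ e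
    have := hg ⟨j.val - 4, by omega⟩
    simp only [f] at hf
    split_ifs at hf <;> first | omega | grind
  have hadj : ∀ i j : Fin (5 + s), ((i.val + 1 = j.val ∧ j.val < 5) ∨
      (i.val = 5 - 2 ∧ 5 ≤ j.val)) → G.Adj (f i) (f j) := by
    intro i j hij
    have := hg ⟨j.val - 4, by omega⟩
    simp only [f]
    split_ifs <;> first | omega | (simp only [hba.symm, hcb.symm, hvc.symm, this])
  refine ⟨⟨f, ?_⟩, ?_⟩
  · intro i j hij
    rw [broom, SimpleGraph.fromRel_adj] at hij
    rcases hij.2 with h | h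
    · exact hadj i j h
    · exact (hadj j i h).symm
  · intro i j hij
    change f i = f j at hij
    rcases lt_trichotomy i.val j.val with h | h | h
    · exact absurd hij (hinj i j h)
    · exact Fin.ext h
    · exact absurd hij.symm (hinj j i h)

theorem BroomFree.disjoint_neighborFinset {V : Type*} [Fintype V] {G : SimpleGraph V} {s : ℕ}
    (hG : BroomFree 5 s G) {u w : V} (hu : s + 4 ≤ G.degree u) (hw : s + 4 ≤ G.degree w)
    (huw : u ≠ w) : Disjoint (G.neighborFinset u) (G.neighborFinset w) := by
  rw [Finset.disjoint_left]
  intro c hc hc'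
  rw [mem_neighborFinset] at hc hc'
  have hsub : G.neighborFinset w ⊆ {u, c} := by
    intro a ha
    rw [mem_neighborFinset] at ha
    have := hG.eq_or_eq hu hc hc'.symm ha
    simp only [mem_insert, mem_singleton]
    tauto
  have h1 := (card_le_card hsub).trans card_le_two
  rw [card_neighborFinset_eq_degree] at h1
  omega

theorem BroomFree.exists_isStarWithMatching {V : Type*} [Fintype V] {G : SimpleGraph V} {s : ℕ}
    (hG : BroomFree 5 s G) {v : V} (hv : s + 4 ≤ G.degree v)
    (hd : Fintype.card V - 1 ≤ G.degree v) : ∃ σ, IsStarWithMatching G v σ := by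
  have hadj : ∀ c, c ≠ v → G.Adj v c := by
    have hN : G.neighborFinset v = univ.erase v := by
      apply eq_of_subset_of_card_le
      · intro c hc
        rw [mem_neighborFinset] at hc
        simp [hc.ne']
      · rwa [card_erase_of_mem (mem_univ _), card_univ, card_neighborFinset_eq_degree]
    intro c hc
    rw [← mem_neighborFinset, hN]
    simp [hc]
  have huniq : ∀ c b a, c ≠ v → b ≠ v → a ≠ v → G.Adj c b → G.Adj c a → a = b := by
    intro c b a hc hb ha hcb hca
    have := hG.eq_or_eq hv (hadj b hb) hcb.symm hca
    tauto
  let f : V → V := fun c => if h : c ≠ v ∧ ∃ b, b ≠ v ∧ G.Adj c b then h.2.choose else c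
  have hf : ∀ c b, c ≠ v → b ≠ v → G.Adj c b → f c = b := by
    intro c b hc hb hcb
    have h : c ≠ v ∧ ∃ b, b ≠ v ∧ G.Adj c b := ⟨hc, b, hb, hcb⟩
    have h' := h.2.choose_spec
    simp only [f, dif_pos h]
    exact huniq c b _ hc hb h'.1 hcb h'.2
  have hf' : ∀ c, f c = c ∨ c ≠ v ∧ f c ≠ v ∧ G.Adj c (f c) := by
    intro c
    by_cases h : c ≠ v ∧ ∃ b, b ≠ v ∧ G.Adj c b
    · have h' := h.2.choose_spec
      right
      simp only [f, dif_pos h]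
      exact ⟨h.1, h'⟩
    · left
      simp only [f, dif_neg h]
  have hinv : Function.Involutive f := by
    intro c
    rcases hf' c with h | ⟨h1, h2, h3⟩
    · rw [h, h]
    · exact hf _ _ h2 h1 h3.symm
  refine ⟨hinv.toPerm, ?_, ?_, ?_⟩
  · ext a
    simp [pow_two, hinv a]
  · have := hf' v
    change f v = v
    tauto
  · intro a b
    simp only [Function.Involutive.coe_toPerm]
    constructor
    · intro hab
      refine ⟨hab.ne, ?_⟩
      by_contra! h
      exact h.2.2 (hf a b h.1 h.2.1 hab)
    · rintro ⟨hab, rfl | rfl | h⟩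
      · exact hadj b hab.symm
      · exact (hadj a hab).symm
      · rcases hf' a with h' | ⟨_, _, h'⟩
        · exact absurd (h'.symm.trans h) hab
        · rwa [h] at h'

theorem BroomFree.sum_degree_le_card {V : Type*} [Fintype V] {G : SimpleGraph V} {s : ℕ}
    (hG : BroomFree 5 s G) : ∑ v with s + 4 ≤ G.degree v, G.degree v ≤ Fintype.card V := by
  have h : (({v | s + 4 ≤ G.degree v} : Finset V) : Set V).PairwiseDisjoint
      fun v => G.neighborFinset v := by
    intro u hu w hw huw
    simp only [coe_filter, mem_univ, true_and, Set.mem_ofPred_eq] at hu hw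
    exact hG.disjoint_neighborFinset hu hw huw
  have h1 := card_biUnion h
  simp only [card_neighborFinset_eq_degree] at h1
  rw [← h1]
  exact card_le_univ _

theorem BroomFree.sum_degree_le_sub {V : Type*} [Fintype V] {G : SimpleGraph V} {s : ℕ}
    (hG : BroomFree 5 s G) {v : V} (hv : s + 4 ≤ G.degree v) :
    ∑ u ∈ ({u | s + 4 ≤ G.degree u} : Finset V).erase v, G.degree u + G.degree v ≤
      Fintype.card V := by
  rw [sum_erase_add _ _ (by simpa using hv)]
  exact hG.sum_degree_le_card

theorem BroomFree.degree_add_degree_le {V : Type*} [Fintype V] {G : SimpleGraph V} {s : ℕ}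
    (hG : BroomFree 5 s G) {u v : V} (hv : s + 4 ≤ G.degree v) (hu : s + 4 ≤ G.degree u)
    (huv : u ≠ v) : G.degree u + G.degree v ≤ Fintype.card V := by
  have h := single_le_sum (f := fun u => G.degree u) (fun _ _ => Nat.zero_le _)
    (show u ∈ ({u | s + 4 ≤ G.degree u} : Finset V).erase v by simpa [huv] using hu)
  have := hG.sum_degree_le_sub hv
  omega

theorem BroomFree.sum_sq_degree_le {V : Type*} [Fintype V] {G : SimpleGraph V} {s m : ℕ}
    (hG : BroomFree 5 s G) {v : V} (hv : s + 4 ≤ G.degree v)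
    (hm : ∀ u, s + 4 ≤ G.degree u → u ≠ v → G.degree u ≤ m) :
    ∑ u with s + 4 ≤ G.degree u, G.degree u ^ 2 ≤
      G.degree v ^ 2 + (Fintype.card V - G.degree v) * m := by
  rw [← add_sum_erase _ _ (show v ∈ ({u | s + 4 ≤ G.degree u} : Finset V) by simpa using hv)]
  have h := hG.sum_degree_le_sub hv
  gcongr
  calc ∑ u ∈ ({u | s + 4 ≤ G.degree u} : Finset V).erase v, G.degree u ^ 2
      ≤ ∑ u ∈ ({u | s + 4 ≤ G.degree u} : Finset V).erase v, G.degree u * m := by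
        refine sum_le_sum fun u hu => ?_
        simp only [mem_erase, mem_filter, mem_univ, true_and] at hu
        rw [pow_two]
        exact Nat.mul_le_mul_left _ (hm u hu.2 hu.1)
    _ ≤ _ := by
        rw [← sum_mul]
        exact Nat.mul_le_mul_right _ (by omega)

theorem sum_degree_pow_le {V : Type*} [Fintype V] {G : SimpleGraph V} {k r : ℕ} (hr : 2 ≤ r)
    {d : ℕ} (hd : ∀ u, G.degree u ≤ d) :
    ∑ u, G.degree u ^ r ≤
      d ^ (r - 2) * ∑ u with k ≤ G.degree u, G.degree u ^ 2 + Fintype.card V * k ^ r := by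
  rw [← sum_filter_add_sum_filter_not univ (fun u => k ≤ G.degree u)]
  gcongr
  · rw [mul_sum]
    refine sum_le_sum fun u _ => ?_
    calc G.degree u ^ r = G.degree u ^ (r - 2) * G.degree u ^ 2 := by
          rw [← pow_add, Nat.sub_add_cancel hr]
      _ ≤ _ := by gcongr; exact hd u
  · calc ∑ u with ¬ k ≤ G.degree u, G.degree u ^ r
        ≤ ∑ u with ¬ k ≤ G.degree u, k ^ r := by
          refine sum_le_sum fun u hu => ?_
          simp only [mem_filter, mem_univ, true_and, not_le] at hu
          exact Nat.pow_le_pow_left hu.le r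
      _ ≤ _ := by
          rw [sum_const, smul_eq_mul]
          exact Nat.mul_le_mul_right _ (card_le_univ _)

/-- The degree power sum of a broom-free graph in which one vertex has large degree, but is not
adjacent to all others. -/
theorem BroomFree.sum_degree_pow_le_of_large_degree {V : Type*} [Fintype V] {G : SimpleGraph V}
    {s r x : ℕ} (hG : BroomFree 5 s G) {v : V} (hv : s + 4 ≤ G.degree v) (hs : s + 4 ≤ x)
    (hd : G.degree v + 2 ≤ Fintype.card V) (hx : Fintype.card V ≤ G.degree v + x) :
    ∑ u, G.degree u ^ r ≤
      G.degree v ^ r + (Fintype.card V - 2) * 2 ^ r + 2 * x * x ^ r := by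
  have hM : ∀ u, u ≠ v → G.degree u ≤ x := by
    intro u hu
    by_cases h : s + 4 ≤ G.degree u
    · have := hG.degree_add_degree_le hv h hu
      omega
    · omega
  let T : Finset V := univ \ insert v (G.neighborFinset v)
  have hmemT : ∀ b, b ∈ T ↔ b ≠ v ∧ ¬ G.Adj v b := by
    intro b
    simp [T]
  have hT : #T + 1 + G.degree v = Fintype.card V := by
    have h1 := card_sdiff_add_card_eq_card (subset_univ (insert v (G.neighborFinset v)))
    rw [card_insert_of_notMem (by simp), card_neighborFinset_eq_degree, card_univ] at h1
    simp only [T]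
    omega
  let A : Finset V := T.biUnion fun b => G.neighborFinset b ∩ G.neighborFinset v
  have hA : #A ≤ #T * 1 := by
    refine card_biUnion_le_card_mul _ _ _ fun b hb => card_le_one.2 fun c hc c' hc' => ?_
    rw [hmemT] at hb
    simp only [mem_inter, mem_neighborFinset] at hc hc'
    have := hG.eq_or_eq hv hc.2 hc.1.symm hc'.1
    have := hc'.2.ne'
    tauto
  have hsub : A ∪ T ⊆ univ.erase v := by
    intro u hu
    simp only [mem_erase, mem_univ, and_true]
    rcases mem_union.1 hu with h | h
    · simp only [A, mem_biUnion, mem_inter, mem_neighborFinset] at h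
      obtain ⟨_, _, _, h⟩ := h
      exact h.ne'
    · exact ((hmemT u).1 h).1
  have hB : #(A ∪ T) ≤ 2 * x := (card_union_le _ _).trans (by omega)
  have hB' : #T ≤ #(A ∪ T) := card_le_card subset_union_right
  have hdeg : ∀ u ∈ univ.erase v \ (A ∪ T), G.degree u ≤ 2 := by
    intro u hu
    simp only [mem_sdiff, mem_erase, mem_univ, and_true, mem_union, hmemT, not_or, not_and,
      not_not, A, mem_biUnion, mem_inter, mem_neighborFinset, not_exists] at hu
    have hvu : G.Adj v u := hu.2.2 hu.1
    have h1 : #((G.neighborFinset u).erase v) ≤ 1 := by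
      refine card_le_one.2 fun a ha b hb => ?_
      simp only [mem_erase, mem_neighborFinset] at ha hb
      have hva : G.Adj v a := by
        by_contra h
        exact hu.2.1 a ⟨ha.1, h⟩ ha.2.symm hvu
      have := hG.eq_or_eq hv hva ha.2.symm hb.2
      grind
    rw [card_erase_of_mem (by simpa using hvu.symm), card_neighborFinset_eq_degree] at h1
    omega
  rw [← add_sum_erase _ _ (mem_univ v), ← sum_sdiff hsub, add_assoc]
  gcongr
  · calc _ ≤ ∑ u ∈ univ.erase v \ (A ∪ T), 2 ^ r :=
          sum_le_sum fun u hu => Nat.pow_le_pow_left (hdeg u hu) r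
      _ ≤ _ := by
          rw [sum_const, smul_eq_mul, card_sdiff_of_subset hsub, card_erase_of_mem (mem_univ _),
            card_univ]
          exact Nat.mul_le_mul_right _ (by omega)
  · calc _ ≤ ∑ u ∈ A ∪ T, x ^ r :=
          sum_le_sum fun u hu => Nat.pow_le_pow_left (hM u (mem_erase.1 (hsub hu)).1) r
      _ ≤ _ := by
          rw [sum_const, smul_eq_mul]
          exact Nat.mul_le_mul_right _ hB

theorem BroomFree.sum_degree_pow_lt_or {V : Type*} [Fintype V] {G : SimpleGraph V}
    {s r x : ℕ} (hG : BroomFree 5 s G) (hr : 2 ≤ r) (hx : x = (s + 4) ^ r + 3)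
    (hN : 2 * x * x ^ r + 2 * x + 10 ≤ Fintype.card V) :
    ∑ u, G.degree u ^ r < (Fintype.card V - 1) ^ r + (Fintype.card V - 2) * 2 ^ r ∨
      ∃ v σ, IsStarWithMatching G v σ := by
  obtain ⟨m, hm⟩ : ∃ m, Fintype.card V = m + 1 := ⟨Fintype.card V - 1, by omega⟩
  have hsx : s + 4 ≤ x := by
    have := Nat.le_self_pow (show r ≠ 0 by omega) (s + 4)
    omega
  have hV : Nonempty V := Fintype.card_pos_iff.1 (by omega)
  obtain ⟨v, -, hmax⟩ := exists_max_image univ (fun v => G.degree v) univ_nonempty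
  replace hmax : ∀ u, G.degree u ≤ G.degree v := fun u => hmax u (mem_univ u)
  have hdm : G.degree v ≤ m := by
    have := G.degree_lt_card_verts v
    omega
  have hm0 : 0 < m := by omega
  have key : ∑ u with s + 4 ≤ G.degree u, G.degree u ^ 2 + (m + 1) * (x - 3) + 1 ≤ m ^ 2 →
      ∑ u, G.degree u ^ r < m ^ r + (m - 1) * 2 ^ r := by
    intro h
    refine lt_of_lt_of_le ?_ (Nat.le_add_right _ _)
    calc ∑ u, G.degree u ^ r ≤ m ^ (r - 2) * ∑ u with s + 4 ≤ G.degree u, G.degree u ^ 2 +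
          (m + 1) * (x - 3) := by
          rw [hx, Nat.add_sub_cancel, ← hm]
          exact sum_degree_pow_le hr fun u => (hmax u).trans hdm
      _ ≤ m ^ (r - 2) * (∑ u with s + 4 ≤ G.degree u, G.degree u ^ 2 + (m + 1) * (x - 3)) := by
          rw [mul_add]
          refine Nat.add_le_add_left ?_ _
          exact Nat.le_mul_of_pos_left _ (Nat.pow_pos hm0)
      _ < m ^ (r - 2) * m ^ 2 := by
          exact Nat.mul_lt_mul_of_pos_left (by omega) (Nat.pow_pos hm0)
      _ = m ^ r := by rw [← pow_add, Nat.sub_add_cancel hr]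
  obtain ⟨C, rfl⟩ : ∃ C, x = C + 3 := ⟨x - 3, by omega⟩
  rw [Nat.add_sub_cancel] at key
  have hmC : 2 * (C + 3) + 9 ≤ m := by omega
  rw [hm, Nat.add_sub_cancel, show m + 1 - 2 = m - 1 by omega]
  by_cases hv : s + 4 ≤ G.degree v
  · by_cases h1 : m ≤ G.degree v
    · right
      exact ⟨v, hG.exists_isStarWithMatching hv (by omega)⟩
    left
    by_cases h2 : m + 1 ≤ G.degree v + (C + 3)
    · have h3 := hG.sum_degree_pow_le_of_large_degree (r := r) hv hsx (by omega) (by omega)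
      rw [hm, show m + 1 - 2 = m - 1 by omega] at h3
      have h4 : G.degree v ^ r + m ≤ m ^ r := by
        obtain ⟨t, rfl⟩ : ∃ t, r = t + 1 := ⟨r - 1, by omega⟩
        calc G.degree v ^ (t + 1) + m ≤ m ^ t * (m - 1) + m ^ t := by
              rw [pow_succ]
              gcongr
              · omega
              · exact Nat.le_self_pow (by omega) m
          _ = m ^ (t + 1) := by
              rw [← Nat.mul_succ, pow_succ]
              congr 1
              omega
      omega
    · apply key
      by_cases h5 : 2 * G.degree v ≤ m + 1
      · have h6 := hG.sum_sq_degree_le hv fun u _ _ => hmax u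
        rw [hm] at h6
        obtain ⟨y, hy⟩ : ∃ y, m + 1 = G.degree v + y := ⟨m + 1 - G.degree v, by omega⟩
        rw [hy, Nat.add_sub_cancel_left] at h6
        nlinarith
      · have h6 := hG.sum_sq_degree_le (m := m + 1 - G.degree v) hv fun u hu huv => by
          have := hG.degree_add_degree_le hv hu huv
          omega
        rw [hm] at h6
        obtain ⟨y, hy⟩ : ∃ y, m + 1 = G.degree v + y := ⟨m + 1 - G.degree v, by omega⟩
        rw [hy, Nat.add_sub_cancel_left] at h6
        obtain ⟨z, rfl⟩ : ∃ z, y = C + 3 + z := ⟨y - (C + 3), by omega⟩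
        nlinarith
  · left
    apply key
    have h0 : ∑ u with s + 4 ≤ G.degree u, G.degree u ^ 2 = 0 := by
      rw [filter_eq_empty_iff.2, sum_empty]
      intro u _ hu
      exact hv (hu.trans (hmax u))
    rw [h0]
    nlinarith

theorem mul_two_pow_add_sub_lt {m k l r : ℕ} (hkl : k < l) (hl : l ≤ m) (hr : 2 ≤ r) :
    k * 2 ^ r + (m - k) < l * 2 ^ r + (m - l) := by
  obtain ⟨j, rfl⟩ : ∃ j, l = k + j := ⟨l - k, by omega⟩
  have h : 2 ^ 2 ≤ 2 ^ r := Nat.pow_le_pow_right (by omega) hr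
  have : j * 2 ^ 2 ≤ j * 2 ^ r := Nat.mul_le_mul_left _ h
  rw [add_mul]
  omega

theorem sum_degree_pow_congr {V W : Type*} [Fintype V] [Fintype W] {G : SimpleGraph V}
    {H : SimpleGraph W} (e : G ≃g H) (r : ℕ) :
    ∑ v, G.degree v ^ r = ∑ w, H.degree w ^ r :=
  Fintype.sum_equiv e.toEquiv _ _ fun v => by
    have := e.degree_eq v
    simp_all

/-- For `r ≥ 2`, `s ≥ 1` and all sufficiently large `n`, every `n`-vertex
`B(5,s)`-free graph `G` satisfies
`e_r(G) ≤ e_r(F_n) = (n-1)^r + 2⌊(n-1)/2⌋·2^r + (n-1-2⌊(n-1)/2⌋)`, with equality iff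
`G ≅ F_n`. -/
theorem er_extremal_broom_five (r s : ℕ) (hr : 2 ≤ r) (hs : 1 ≤ s) :
    ∃ N : ℕ, ∀ n : ℕ, N ≤ n → ∀ G : SimpleGraph (Fin n), BroomFree 5 s G →
      (∑ v : Fin n, (Fgraph n).degree v ^ r =
          (n - 1) ^ r + 2 * ((n - 1) / 2) * 2 ^ r + (n - 1 - 2 * ((n - 1) / 2))) ∧
      (∑ v : Fin n, G.degree v ^ r ≤
          (n - 1) ^ r + 2 * ((n - 1) / 2) * 2 ^ r + (n - 1 - 2 * ((n - 1) / 2))) ∧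
      ((∑ v : Fin n, G.degree v ^ r =
          (n - 1) ^ r + 2 * ((n - 1) / 2) * 2 ^ r + (n - 1 - 2 * ((n - 1) / 2))) ↔
        Nonempty (G ≃g Fgraph n)) := by
  set x := (s + 4) ^ r + 3 with hx
  refine ⟨2 * x * x ^ r + 2 * x + 10, fun n hn G hG => ?_⟩
  have hn0 : 0 < n := by omega
  have hF := sum_degree_pow_Fgraph hn0 r
  refine ⟨hF, ?_⟩
  have hiso : Nonempty (G ≃g Fgraph n) → ∑ v : Fin n, G.degree v ^ r =
      (n - 1) ^ r + 2 * ((n - 1) / 2) * 2 ^ r + (n - 1 - 2 * ((n - 1) / 2)) := by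
    rintro ⟨e⟩
    rw [sum_degree_pow_congr e, hF]
  rcases hG.sum_degree_pow_lt_or hr hx (by simpa using hn) with hlt | ⟨v, σ, h⟩
  · rw [Fintype.card_fin] at hlt
    have hle : (n - 2) * 2 ^ r ≤ 2 * ((n - 1) / 2) * 2 ^ r :=
      Nat.mul_le_mul_right _ (by omega)
    exact ⟨by omega, fun heq => absurd heq (by omega), hiso⟩
  · have hsum := h.sum_degree_pow r
    have hdvd := Equiv.Perm.two_dvd_card_support h.sq_eq_one
    have hle := h.card_support_le
    rw [Fintype.card_fin] at hsum hle
    rcases Nat.lt_or_ge #σ.support (2 * ((n - 1) / 2)) with hlt | hge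
    · have := mul_two_pow_add_sub_lt (m := n - 1) hlt (by omega) hr
      exact ⟨by omega, fun heq => absurd heq (by omega), hiso⟩
    · have hcard : #σ.support = 2 * ((n - 1) / 2) := by omega
      have hex := h.nonempty_iso (isStarWithMatching_Fgraph hn0) (Equiv.refl _)
        (hcard.trans (card_support_pairSwap hn0).symm)
      exact ⟨(hiso hex).le, fun _ => hex, hiso⟩
end
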